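/- Let p > 1, a ≥ 0, β ≤ 1 and b ∈ ℝ with (a+n)·(2β/(1+β)) < n + b − p (here n = 2). Then there exists a bounded proper subdomain Ω ⊂ ℝ² satisfying the β-quasihyperbolic boundary condition on which the weighted Korn inequality (K_{p,a,b−p}) fails; that is, there is no constant C > 0 such that ∫_Ω |Dv|^p ρ^a dx ≤ C { ∫_Ω |ε(v)|^p ρ^{b−p} dx + ∫_Ω |v|^p ρ^a dx } for all v ∈ W^{1,p}(Ω,ρ^a)². -/

import Mathlib

open MeasureTheory Set Filter
open scoped ENNReal NNReal Topology

noncomputable section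

abbrev Evec (n : ℕ) := EuclideanSpace ℝ (Fin n)

/-- `ρ(x) = dist(x, ∂Ω)`, the distance to the boundary of `Ω`. -/
def bdist {n : ℕ} (Ω : Set (Evec n)) (x : Evec n) : ℝ := Metric.infDist x (frontier Ω)

/-- A bounded domain: open, connected and bounded. -/
def IsBoundedDomain {n : ℕ} (Ω : Set (Evec n)) : Prop :=
  IsOpen Ω ∧ IsConnected Ω ∧ Bornology.IsBounded Ω

/-- A closed cube in `ℝⁿ`. -/
def IsClosedCube {n : ℕ} (Q : Set (Evec n)) : Prop :=
  ∃ (c : Evec n) (r : ℝ), 0 < r ∧ Q = {x : Evec n | ∀ i, |x i - c i| ≤ r}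

/-- The weighted `p`-energy `∫_S |g(x)|^p ρ(x)^a dx`, where `ρ` is the distance
to the boundary of `Ω`. -/
def wIp {n : ℕ} (Ω S : Set (Evec n)) (p a : ℝ) (g : Evec n → ℝ) : ℝ≥0∞ :=
  ∫⁻ x in S, ENNReal.ofReal (|g x| ^ p * bdist Ω x ^ a)

/-- The weighted `L^p(S, ρ^a)` norm `(∫_S |g(x)|^p ρ(x)^a dx)^{1/p}`. -/
def wLp {n : ℕ} (Ω S : Set (Evec n)) (p a : ℝ) (g : Evec n → ℝ) : ℝ≥0∞ :=
  wIp Ω S p a g ^ (1 / p)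

/-- The weighted average `u_{Ω,a} = (∫_Ω ρ^a)⁻¹ ∫_Ω u ρ^a`. -/
def wAvg {n : ℕ} (Ω : Set (Evec n)) (a : ℝ) (u : Evec n → ℝ) : ℝ :=
  (∫ x in Ω, bdist Ω x ^ a)⁻¹ * ∫ x in Ω, u x * bdist Ω x ^ a

/-- `|∇u(x)|` for a scalar function `u`. -/
def gradLen {n : ℕ} (u : Evec n → ℝ) (x : Evec n) : ℝ := ‖fderiv ℝ u x‖

/-- The entry `∂v_i/∂x_j (x)` of the gradient matrix `Dv`. -/
def pder {n : ℕ} (v : Evec n → Evec n) (i j : Fin n) (x : Evec n) : ℝ :=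
  fderiv ℝ v x (EuclideanSpace.single j 1) i

/-- `|Dv(x)|`, the (Frobenius) norm of the gradient matrix of a vector field `v`. -/
def DvLen {n : ℕ} (v : Evec n → Evec n) (x : Evec n) : ℝ :=
  Real.sqrt (∑ i, ∑ j, pder v i j x ^ 2)

/-- `|ε(v)(x)|`, the norm of the symmetric part `ε_{ij}(v) = (∂v_i/∂x_j + ∂v_j/∂x_i)/2`
of the gradient matrix. -/
def epsLen {n : ℕ} (v : Evec n → Evec n) (x : Evec n) : ℝ :=
  Real.sqrt (∑ i, ∑ j, ((pder v i j x + pder v j i x) / 2) ^ 2)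

/-- `u ∈ W^{1,p}(Ω, ρ^a, ρ^b)` (scalar case). -/
def MemW1 {n : ℕ} (Ω : Set (Evec n)) (p a b : ℝ) (u : Evec n → ℝ) : Prop :=
  DifferentiableOn ℝ u Ω ∧ wIp Ω Ω p a u < ⊤ ∧ wIp Ω Ω p b (gradLen u) < ⊤

/-- `v ∈ W^{1,p}(Ω, ρ^a, ρ^b)ⁿ` (vector case). -/
def MemW1Vec {n : ℕ} (Ω : Set (Evec n)) (p a b : ℝ) (v : Evec n → Evec n) : Prop :=
  DifferentiableOn ℝ v Ω ∧ wIp Ω Ω p a (fun x => ‖v x‖) < ⊤ ∧ wIp Ω Ω p b (DvLen v) < ⊤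

/-- The weighted Poincaré inequality `(P_{p,a,b})`: there is `C > 0` such that
`∫_Ω |u - u_{Ω,a}|^p ρ^a ≤ C ∫_Ω |∇u|^p ρ^b` for all `u ∈ W^{1,p}(Ω,ρ^a,ρ^b)`. -/
def PoincareIneq {n : ℕ} (Ω : Set (Evec n)) (p a b : ℝ) : Prop :=
  ∃ C > 0, ∀ u : Evec n → ℝ, MemW1 Ω p a b u →
    wIp Ω Ω p a (fun x => u x - wAvg Ω a u) ≤ ENNReal.ofReal C * wIp Ω Ω p b (gradLen u)

/-- The quasihyperbolic length `∫ ‖γ'(t)‖ / dist(γ(t), ∂Ω) dt` of a curve `γ : [0,1] → Ω`. -/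
def qhLen {n : ℕ} (Ω : Set (Evec n)) (γ : ℝ → Evec n) : ℝ≥0∞ :=
  ∫⁻ t in Icc (0:ℝ) 1, ENNReal.ofReal (‖deriv γ t‖ / bdist Ω (γ t))

/-- `Ω` satisfies the `β`-quasihyperbolic boundary condition: for some base point `x₀` and
some constant `C₀`, the quasihyperbolic distance `k(x, x₀)` (infimum of quasihyperbolic
lengths of Lipschitz curves joining `x` to `x₀` in `Ω`) satisfies
`k(x,x₀) ≤ (1/β) log( dist(x₀,∂Ω) / dist(x,∂Ω) ) + C₀` for every `x ∈ Ω`. -/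
def QHBC {n : ℕ} (Ω : Set (Evec n)) (β : ℝ) : Prop :=
  ∃ x₀ ∈ Ω, ∃ C₀ : ℝ, ∀ x ∈ Ω, ∀ ε > (0:ℝ), ∃ γ : ℝ → Evec n, ∃ K : ℝ≥0,
    LipschitzOnWith K γ (Icc 0 1) ∧ γ 0 = x ∧ γ 1 = x₀ ∧ (∀ t ∈ Icc (0:ℝ) 1, γ t ∈ Ω) ∧
    qhLen Ω γ ≤ ENNReal.ofReal ((1/β) * Real.log (bdist Ω x₀ / bdist Ω x) + C₀ + ε)

lemma bdist_le_dist {n : ℕ} {Ω : Set (Evec n)} {x w : Evec n} (hx : x ∈ Ω) (hw : w ∉ Ω) :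
    bdist Ω x ≤ dist x w := by
  have hne : Ω ≠ univ := fun h => hw (h ▸ mem_univ w)
  obtain ⟨y, hy, hxy⟩ := exists_mem_frontier_infDist_compl_eq_dist hx hne
  calc bdist Ω x ≤ dist x y := Metric.infDist_le_dist_of_mem hy
    _ = Metric.infDist x Ωᶜ := hxy.symm
    _ ≤ dist x w := Metric.infDist_le_dist_of_mem hw

lemma le_bdist_of_ball_subset {n : ℕ} {Ω : Set (Evec n)} {x : Evec n} {R : ℝ} (hΩ : IsOpen Ω)
    (hf : (frontier Ω).Nonempty) (h : Metric.ball x R ⊆ Ω) : R ≤ bdist Ω x := by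
  rw [bdist, Metric.le_infDist hf]
  intro y hy
  by_contra! hlt
  have h1 : y ∈ Ω := h (by rwa [Metric.mem_ball, dist_comm])
  exact hy.2 (by rwa [hΩ.interior_eq])

lemma bdist_pos {n : ℕ} {Ω : Set (Evec n)} {x : Evec n} (hΩ : IsOpen Ω)
    (hf : (frontier Ω).Nonempty) (hx : x ∈ Ω) : 0 < bdist Ω x := by
  obtain ⟨R, hR, h⟩ := Metric.isOpen_iff.1 hΩ x hx
  exact hR.trans_le (le_bdist_of_ball_subset hΩ hf h)

lemma ball_bdist_subset {n : ℕ} {Ω : Set (Evec n)} {x : Evec n} (hx : x ∈ Ω) :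
    Metric.ball x (bdist Ω x) ⊆ Ω := by
  intro y hy
  by_contra h
  exact absurd (bdist_le_dist hx h) (by rw [Metric.mem_ball, dist_comm] at hy; exact not_le.2 hy)

/-- Some Lipschitz curve in `Ω` from `x` to `y` has quasihyperbolic length at most `L`. -/
def QHJoin {n : ℕ} (Ω : Set (Evec n)) (x y : Evec n) (L : ℝ) : Prop :=
  ∃ γ : ℝ → Evec n, ∃ K : ℝ≥0, LipschitzOnWith K γ (Icc 0 1) ∧ γ 0 = x ∧ γ 1 = y ∧
    (∀ t ∈ Icc (0:ℝ) 1, γ t ∈ Ω) ∧ qhLen Ω γ ≤ ENNReal.ofReal L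

lemma QHJoin.mono {n : ℕ} {Ω : Set (Evec n)} {x y : Evec n} {L L' : ℝ} (h : QHJoin Ω x y L)
    (hL : L ≤ L') : QHJoin Ω x y L' := by
  obtain ⟨γ, K, h1, h2, h3, h4, h5⟩ := h
  exact ⟨γ, K, h1, h2, h3, h4, h5.trans (ENNReal.ofReal_le_ofReal hL)⟩

lemma QHJoin.joinedIn {n : ℕ} {Ω : Set (Evec n)} {x y : Evec n} {L : ℝ}
    (h : QHJoin Ω x y L) : JoinedIn Ω x y := by
  obtain ⟨γ, K, h1, h2, h3, h4, -⟩ := h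
  exact JoinedIn.ofLine h1.continuousOn h2 h3 (by rintro _ ⟨t, ht, rfl⟩; exact h4 t ht)

/-- Affine reparametrization of quasihyperbolic length on an interval. -/
lemma lintegral_affine_comp_le {F : ℝ → ℝ≥0∞} {S : Set ℝ} (hS : MeasurableSet S) (c d : ℝ)
    (hc : c ≠ 0) (hmaps : ∀ t ∈ S, c * t + d ∈ Icc (0:ℝ) 1) :
    ∫⁻ t in S, ENNReal.ofReal |c| * F (c * t + d) ≤ ∫⁻ t in Icc (0:ℝ) 1, F t := by
  have hd : ∀ t ∈ S, HasDerivWithinAt (fun t => c * t + d) ((fun _ => c) t) S t := fun t _ => by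
    simpa using (((hasDerivAt_id t).const_mul c).add_const d).hasDerivWithinAt
  have hinj : InjOn (fun t => c * t + d) S := fun s _ t _ h => by
    simpa [hc] using h
  rw [← lintegral_image_eq_lintegral_abs_deriv_mul hS hd hinj]
  exact lintegral_mono_set (by rintro _ ⟨t, ht, rfl⟩; exact hmaps t ht)

lemma QHJoin.symm {n : ℕ} {Ω : Set (Evec n)} {x y : Evec n} {L : ℝ} (h : QHJoin Ω x y L) :
    QHJoin Ω y x L := by
  obtain ⟨γ, K, h1, h2, h3, h4, h5⟩ := h
  have hm : ∀ t ∈ Icc (0:ℝ) 1, 1 - t ∈ Icc (0:ℝ) 1 := fun t ht =>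
    ⟨by linarith [ht.2], by linarith [ht.1]⟩
  refine ⟨fun t => γ (1 - t), K, ?_, by simpa, by simpa, fun t ht => h4 _ (hm t ht), ?_⟩
  · refine LipschitzOnWith.of_dist_le_mul fun s hs t ht => ?_
    have := h1.dist_le_mul _ (hm s hs) _ (hm t ht)
    rwa [dist_sub_left] at this
  · refine le_trans ?_ h5
    refine le_trans (le_of_eq ?_) (lintegral_affine_comp_le measurableSet_Icc (-1) 1 (by norm_num)
      fun t ht => by have := hm t ht; rwa [show -1 * t + 1 = 1 - t by ring])
    refine lintegral_congr fun t => ?_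
    rw [deriv_comp_const_sub, norm_neg, show -1 * t + 1 = 1 - t by ring]
    simp

lemma QHJoin.trans {n : ℕ} {Ω : Set (Evec n)} {x y z : Evec n} {L L' : ℝ} (h : QHJoin Ω x y L)
    (h' : QHJoin Ω y z L') (hL : 0 ≤ L) (hL' : 0 ≤ L') : QHJoin Ω x z (L + L') := by
  obtain ⟨γ, K, h1, h2, h3, h4, h5⟩ := h
  obtain ⟨γ', K', h1', h2', h3', h4', h5'⟩ := h'
  set g : ℝ → Evec n := fun t => γ (min (2 * t) 1) + γ' (max (2 * t - 1) 0) - y with hg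
  have hl : ∀ t ≤ (1:ℝ) / 2, g t = γ (2 * t + 0) := fun t ht => by
    simp only [hg]
    rw [min_eq_left (by linarith), max_eq_right (by linarith), h2', add_zero]; simp
  have hr : ∀ t ≥ (1:ℝ) / 2, g t = γ' (2 * t + -1) := fun t ht => by
    simp only [hg]
    rw [min_eq_right (by linarith), max_eq_left (by linarith), h3]; simp [sub_eq_add_neg]
  have hm1 : ∀ t ∈ Icc (0:ℝ) 1, min (2 * t) 1 ∈ Icc (0:ℝ) 1 := fun t ht =>
    ⟨le_min (by linarith [ht.1]) zero_le_one, min_le_right _ _⟩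
  have hm2 : ∀ t ∈ Icc (0:ℝ) 1, max (2 * t - 1) 0 ∈ Icc (0:ℝ) 1 := fun t ht =>
    ⟨le_max_right _ _, max_le (by linarith [ht.2]) zero_le_one⟩
  have hlip : LipschitzOnWith (K * 2 + K' * 2) g (Icc 0 1) := by
    have e : LipschitzWith 2 (fun t : ℝ => 2 * t) := LipschitzWith.of_dist_le_mul fun s t => by
      rw [Real.dist_eq, Real.dist_eq, ← mul_sub, abs_mul]; simp
    have e' : LipschitzWith 2 (fun t : ℝ => 2 * t - 1) := LipschitzWith.of_dist_le_mul fun s t => by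
      rw [dist_sub_right]; simpa using e.dist_le_mul s t
    have a := h1.comp (e.min_const 1).lipschitzOnWith hm1
    have b := h1'.comp (e'.max_const 0).lipschitzOnWith hm2
    have := (a.add b).sub (LipschitzWith.const y).lipschitzOnWith
    simpa using this
  refine ⟨g, _, hlip, by rw [hl 0 (by norm_num)]; simpa, ?_, ?_, ?_⟩
  · rw [hr 1 (by norm_num)]; norm_num; exact h3'
  · intro t ht
    rcases le_total t (1/2) with h | h
    · rw [hl t h]; exact h4 _ ⟨by linarith [ht.1], by linarith⟩
    · rw [hr t h]; exact h4' _ ⟨by linarith, by linarith [ht.2]⟩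
  · rw [ENNReal.ofReal_add hL hL']
    refine le_trans ?_ (add_le_add h5 h5')
    set F : ℝ → ℝ≥0∞ := fun t => ENNReal.ofReal (‖deriv g t‖ / bdist Ω (g t)) with hF
    have hsub : (Icc (0:ℝ) 1) ≤ᵐ[volume] (Ioo (0:ℝ) (1/2) ∪ Ioo (1/2) 1 : Set ℝ) := by
      have h0 : volume ({0, 1/2, 1} : Set ℝ) = 0 := (Set.toFinite _).measure_zero _
      filter_upwards [measure_eq_zero_iff_ae_notMem.1 h0] with t ht hI
      simp only [mem_insert_iff, mem_singleton_iff, not_or] at ht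
      rcases lt_or_gt_of_ne ht.2.1 with h | h
      · exact Or.inl ⟨lt_of_le_of_ne hI.1 (Ne.symm ht.1), h⟩
      · exact Or.inr ⟨h, lt_of_le_of_ne hI.2 ht.2.2⟩
    calc qhLen Ω g = ∫⁻ t in Icc (0:ℝ) 1, F t := rfl
      _ ≤ ∫⁻ t in (Ioo (0:ℝ) (1/2) ∪ Ioo (1/2) 1 : Set ℝ), F t := lintegral_mono_set' hsub
      _ ≤ _ := lintegral_union_le _ _ _
      _ ≤ _ := add_le_add ?_ ?_
    · refine le_trans (le_of_eq ?_) (lintegral_affine_comp_le measurableSet_Ioo 2 0 (by norm_num)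
        fun t (ht : t ∈ Ioo (0:ℝ) (1/2)) => ⟨by linarith [ht.1], by linarith [ht.2]⟩)
      refine setLIntegral_congr_fun measurableSet_Ioo fun t ht => ?_
      have he : g =ᶠ[𝓝 t] fun t => γ (2 * t) := by
        filter_upwards [Iio_mem_nhds ht.2] with s hs
        rw [hl s (le_of_lt hs), add_zero]
      simp only [hF]
      rw [he.deriv_eq, deriv_comp_mul_left, he.eq_of_nhds, norm_smul, add_zero, mul_div_assoc,
        ENNReal.ofReal_mul (norm_nonneg _), Real.norm_eq_abs]
    · refine le_trans (le_of_eq ?_) (lintegral_affine_comp_le measurableSet_Ioo 2 (-1)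
        (by norm_num)
        fun t (ht : t ∈ Ioo (1/2:ℝ) 1) => ⟨by linarith [ht.1], by linarith [ht.2]⟩)
      refine setLIntegral_congr_fun measurableSet_Ioo fun t ht => ?_
      have he : g =ᶠ[𝓝 t] fun t => (fun s => γ' (s + -1)) (2 * t) := by
        filter_upwards [Ioi_mem_nhds ht.1] with s hs
        rw [hr s (le_of_lt hs)]
      simp only [hF]
      rw [he.deriv_eq, deriv_comp_mul_left 2 (fun s => γ' (s + -1)) t, he.eq_of_nhds, norm_smul,
        deriv_comp_add_const, mul_div_assoc, ENNReal.ofReal_mul (norm_nonneg _), Real.norm_eq_abs]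

lemma lintegral_log_weight_le {L s : ℝ} (hL : 0 ≤ L) (hs : 0 < s) :
    ∫⁻ t in Icc (0:ℝ) 1, ENNReal.ofReal (L * (1 / (t * L + s) + 2 * s / (t * L + s) ^ 2)) ≤
      ENNReal.ofReal (Real.log ((L + s) / s) + 2) := by
  have hpos : ∀ t ∈ Icc (0:ℝ) 1, 0 < t * L + s := fun t ht =>
    add_pos_of_nonneg_of_pos (mul_nonneg ht.1 hL) hs
  have hcont : ContinuousOn
      (fun t : ℝ => L * (1 / (t * L + s) + 2 * s / (t * L + s) ^ 2)) (Icc 0 1) := by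
    have hc : ContinuousOn (fun t : ℝ => t * L + s) (Icc 0 1) := by fun_prop
    exact continuousOn_const.mul ((continuousOn_const.div hc fun t ht => (hpos t ht).ne').add
      (continuousOn_const.div (hc.pow 2) fun t ht => (pow_pos (hpos t ht) 2).ne'))
  rw [← ofReal_integral_eq_lintegral_ofReal (hcont.integrableOn_compact isCompact_Icc)
    ((ae_restrict_iff' measurableSet_Icc).2 (Eventually.of_forall fun t ht => by
      have := hpos t ht
      show 0 ≤ _
      positivity))]
  refine ENNReal.ofReal_le_ofReal ?_
  rw [integral_Icc_eq_integral_Ioc, ← intervalIntegral.integral_of_le zero_le_one,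
    intervalIntegral.integral_eq_sub_of_hasDerivAt
      (f := fun t => Real.log (t * L + s) - 2 * s / (t * L + s))]
  · have h1 : 0 < 2 * s / (1 * L + s) := by
      have := hpos 1 (by simp)
      positivity
    rw [Real.log_div (by linarith) hs.ne']
    have h2 : 2 * s / (0 * L + s) = 2 := by field_simp; ring
    rw [h2]
    simp only [zero_mul, zero_add, one_mul] at *
    linarith
  · intro t ht
    rw [uIcc_of_le zero_le_one] at ht
    have hp := hpos t ht
    have hd : HasDerivAt (fun t : ℝ => t * L + s) L t := by
      simpa using ((hasDerivAt_id t).mul_const L).add_const s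
    have h : HasDerivAt (fun t : ℝ => Real.log (t * L + s) - 2 * s / (t * L + s))
        (L / (t * L + s) - (0 * (t * L + s) - 2 * s * L) / (t * L + s) ^ 2) t :=
      (hd.log hp.ne').sub ((hasDerivAt_const t (2 * s)).div hd hp.ne')
    refine h.congr_deriv ?_
    generalize t * L + s = w at *
    field_simp
    ring
  · rw [intervalIntegrable_iff_integrableOn_Icc_of_le zero_le_one]
    exact hcont.integrableOn_compact isCompact_Icc

/-- Joining a point of a closed ball to the centre of the ball by a straight segment. -/
lemma qhJoin_center {n : ℕ} {Ω : Set (Evec n)} (hΩ : IsOpen Ω) (hf : (frontier Ω).Nonempty)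
    {x z : Evec n} {R s : ℝ} (hz : Metric.ball z R ⊆ Ω) (hxz : dist x z ≤ R) (hs : 0 < s)
    (hx : Metric.ball x (2 * s) ⊆ Ω) :
    QHJoin Ω x z (Real.log ((dist x z + s) / s) + 2) := by
  set L := dist x z with hL
  have hL0 : 0 ≤ L := dist_nonneg
  set γ : ℝ → Evec n := fun t => x + t • (z - x) with hγ
  have hγx : ∀ t ∈ Icc (0:ℝ) 1, dist (γ t) x = t * L := fun t ht => by
    rw [hL, dist_eq_norm, dist_eq_norm, ← norm_neg (x - z), neg_sub]
    simp [hγ, norm_smul, abs_of_nonneg ht.1]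
  have hγz : ∀ t ∈ Icc (0:ℝ) 1, dist (γ t) z = (1 - t) * L := fun t ht => by
    have : γ t - z = (1 - t) • (x - z) := by simp only [hγ]; module
    rw [hL, dist_eq_norm, dist_eq_norm, this, norm_smul, Real.norm_eq_abs,
      abs_of_nonneg (by linarith [ht.2])]
  have hb1 : ∀ t ∈ Icc (0:ℝ) 1, 2 * s - t * L ≤ bdist Ω (γ t) := fun t ht => by
    refine le_bdist_of_ball_subset hΩ hf (subset_trans (Metric.ball_subset_ball' ?_) hx)
    rw [hγx t ht]; linarith
  have hb2 : ∀ t ∈ Icc (0:ℝ) 1, t * L ≤ bdist Ω (γ t) := fun t ht => by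
    refine le_bdist_of_ball_subset hΩ hf (subset_trans (Metric.ball_subset_ball' ?_) hz)
    rw [hγz t ht]; linarith
  have hd : ∀ t, deriv γ t = z - x := fun t => by
    have : HasDerivAt γ ((1:ℝ) • (z - x)) t := ((hasDerivAt_id t).smul_const (z - x)).const_add x
    rw [this.deriv, one_smul]
  refine ⟨γ, L.toNNReal, ?_, by simp [hγ], by simp [hγ], ?_, ?_⟩
  · refine LipschitzOnWith.of_dist_le_mul fun t _ t' _ => le_of_eq ?_
    have : γ t - γ t' = (t - t') • (z - x) := by simp only [hγ]; module
    rw [dist_eq_norm, this, norm_smul, Real.dist_eq, Real.norm_eq_abs, mul_comm]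
    congr 1
    rw [Real.coe_toNNReal _ hL0, hL, dist_comm, dist_eq_norm]
  · intro t ht
    by_cases h : t * L < 2 * s
    · exact hx (by rwa [Metric.mem_ball, hγx t ht])
    · refine hz ?_
      rw [Metric.mem_ball, hγz t ht]
      linarith
  · refine le_trans ?_ (lintegral_log_weight_le hL0 hs)
    refine setLIntegral_mono' measurableSet_Icc fun t ht => ENNReal.ofReal_le_ofReal ?_
    have hnorm : ‖deriv γ t‖ = L := by rw [hd, hL, dist_comm, dist_eq_norm]
    rw [hnorm, div_eq_mul_inv]
    refine mul_le_mul_of_nonneg_left ?_ hL0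
    have h0 : 0 ≤ t * L := mul_nonneg ht.1 hL0
    have e1 := hb1 t ht
    have e2 := hb2 t ht
    generalize t * L = w at *
    generalize bdist Ω (γ t) = D at *
    have hE : 1 / (w + s) + 2 * s / (w + s) ^ 2 = (w + 3 * s) / (w + s) ^ 2 := by
      have : w + s ≠ 0 := by positivity
      field_simp
      ring
    have hD : 0 < D := by linarith
    rw [hE, inv_eq_one_div, div_le_div_iff₀ hD (by positivity)]
    rcases le_total w s with h | h
    · nlinarith [mul_nonneg h0 (sub_nonneg.2 h), mul_nonneg hs.le (sub_nonneg.2 h)]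
    · nlinarith [mul_nonneg h0 (sub_nonneg.2 h), mul_nonneg hs.le (sub_nonneg.2 h)]

/-- The point of the plane with the given coordinates. -/
def pt (a b : ℝ) : Evec 2 := !₂[a, b]

@[simp] lemma pt_zero (a b : ℝ) : pt a b 0 = a := rfl

@[simp] lemma pt_one (a b : ℝ) : pt a b 1 = b := rfl

lemma dist_lt_iff_sq {q w : Evec 2} {R : ℝ} (hR : 0 < R) :
    dist q w < R ↔ (q 0 - w 0) ^ 2 + (q 1 - w 1) ^ 2 < R ^ 2 := by
  rw [EuclideanSpace.dist_eq, Real.sqrt_lt' hR, Fin.sum_univ_two, Real.dist_eq, Real.dist_eq,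
    sq_abs, sq_abs]

lemma dist_le_iff_sq {q w : Evec 2} {R : ℝ} (hR : 0 ≤ R) :
    dist q w ≤ R ↔ (q 0 - w 0) ^ 2 + (q 1 - w 1) ^ 2 ≤ R ^ 2 := by
  rw [EuclideanSpace.dist_eq, Real.sqrt_le_left hR, Fin.sum_univ_two, Real.dist_eq, Real.dist_eq,
    sq_abs, sq_abs]

lemma dist_le_abs_add_abs (q w : Evec 2) : dist q w ≤ |q 0 - w 0| + |q 1 - w 1| := by
  rw [dist_le_iff_sq (by positivity), ← sq_abs (q 0 - w 0), ← sq_abs (q 1 - w 1)]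
  nlinarith [mul_nonneg (abs_nonneg (q 0 - w 0)) (abs_nonneg (q 1 - w 1))]

lemma abs_fst_le_dist (q w : Evec 2) : |q 0 - w 0| ≤ dist q w := by
  simpa [dist_eq_norm] using PiLp.norm_apply_le (q - w) 0

lemma abs_snd_le_dist (q w : Evec 2) : |q 1 - w 1| ≤ dist q w := by
  simpa [dist_eq_norm] using PiLp.norm_apply_le (q - w) 1

/-- Abscissa of the centre of the `i`-th room. -/
def roomX (i : ℕ) : ℝ := (1 / 2) ^ (i + 2)

/-- Radius of the `i`-th room. -/
def roomR (i : ℕ) : ℝ := roomX i / 16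

/-- Half-width of the opening between the `i`-th room and the stadium. -/
def gapH (τ : ℝ) (i : ℕ) : ℝ := roomR i ^ τ

/-- Ordinate of the centre of the `i`-th room. -/
def roomY (τ : ℝ) (i : ℕ) : ℝ := Real.sqrt (roomR i ^ 2 - gapH τ i ^ 2)

/-- The `i`-th room, a disc meeting the line `y = 0` in the opening. -/
def room (τ : ℝ) (i : ℕ) : Set (Evec 2) := Metric.ball (pt (roomX i) (roomY τ i)) (roomR i)

/-- The central room: the unit neighbourhood of a horizontal segment. -/
def stadium : Set (Evec 2) := {q | ∃ s : ℝ, |s| ≤ 1 / 2 ∧ dist q (pt s (-1)) < 1}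

/-- The domain made of the central room and all the small rooms. -/
def roomsDom (τ : ℝ) : Set (Evec 2) := stadium ∪ ⋃ i, room τ i

lemma roomX_pos (i : ℕ) : 0 < roomX i := by unfold roomX; positivity

lemma roomX_le (i : ℕ) : roomX i ≤ 1 / 4 := by
  unfold roomX
  rw [pow_add]
  have : ((1:ℝ) / 2) ^ i ≤ 1 := pow_le_one₀ (by norm_num) (by norm_num)
  linarith

lemma roomR_pos (i : ℕ) : 0 < roomR i := by
  have := roomX_pos i
  unfold roomR; positivity

lemma roomR_le (i : ℕ) : roomR i ≤ 1 / 64 := by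
  have := roomX_le i
  unfold roomR; linarith

lemma gapH_pos (τ : ℝ) (i : ℕ) : 0 < gapH τ i := Real.rpow_pos_of_pos (roomR_pos i) τ

lemma gapH_le {τ : ℝ} (hτ : 1 ≤ τ) (i : ℕ) : gapH τ i ≤ roomR i := by
  have := Real.rpow_le_rpow_of_exponent_ge (roomR_pos i) (by linarith [roomR_le i]) hτ
  rwa [Real.rpow_one] at this

lemma roomY_nonneg (τ : ℝ) (i : ℕ) : 0 ≤ roomY τ i := Real.sqrt_nonneg _

lemma roomY_sq {τ : ℝ} (hτ : 1 ≤ τ) (i : ℕ) :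
    roomY τ i ^ 2 = roomR i ^ 2 - gapH τ i ^ 2 :=
  Real.sq_sqrt (sub_nonneg.2 (pow_le_pow_left₀ (gapH_pos τ i).le (gapH_le hτ i) 2))

lemma roomY_le {τ : ℝ} (hτ : 1 ≤ τ) (i : ℕ) : roomY τ i ≤ roomR i :=
  abs_le_of_sq_le_sq' (by rw [roomY_sq hτ]; nlinarith [gapH_pos τ i]) (roomR_pos i).le |>.2

lemma roomX_sep_of_lt {i j : ℕ} (h : i < j) : roomX j ≤ roomX i / 2 := by
  unfold roomX
  have := pow_le_pow_of_le_one (by norm_num : (0:ℝ) ≤ 1 / 2) (by norm_num)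
    (by omega : i + 2 + 1 ≤ j + 2)
  rw [pow_succ _ (i + 2)] at this
  linarith

lemma roomX_sep {i j : ℕ} (h : i ≠ j) : 4 * roomR i + 4 * roomR j ≤ |roomX i - roomX j| := by
  have hi := roomX_pos i
  have hj := roomX_pos j
  unfold roomR
  rcases lt_or_gt_of_ne h with h | h
  · have := roomX_sep_of_lt h
    rw [abs_of_nonneg (by linarith)]; linarith
  · have := roomX_sep_of_lt h
    rw [abs_sub_comm, abs_of_nonneg (by linarith)]; linarith

lemma mem_room_iff {τ : ℝ} (hτ : 1 ≤ τ) {i : ℕ} {q : Evec 2} :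
    q ∈ room τ i ↔ (q 0 - roomX i) ^ 2 + q 1 ^ 2 < gapH τ i ^ 2 + 2 * q 1 * roomY τ i := by
  rw [room, Metric.mem_ball, dist_lt_iff_sq (roomR_pos i)]
  have := roomY_sq hτ i
  simp only [pt_zero, pt_one]
  constructor <;> intro h <;> nlinarith

lemma abs_lt_roomR_of_mem_room {τ : ℝ} {i : ℕ} {q : Evec 2} (h : q ∈ room τ i) :
    |q 0 - roomX i| < roomR i := by
  have := abs_fst_le_dist q (pt (roomX i) (roomY τ i))
  exact this.trans_lt h

lemma abs_snd_lt_of_mem_room {τ : ℝ} (hτ : 1 ≤ τ) {i : ℕ} {q : Evec 2} (h : q ∈ room τ i) :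
    |q 1| < 2 * roomR i := by
  have h1 := (abs_snd_le_dist q (pt (roomX i) (roomY τ i))).trans_lt h
  have h2 := roomY_le hτ i
  have h3 := roomY_nonneg τ i
  simp only [pt_one, abs_lt] at h1 ⊢
  constructor <;> linarith

lemma near_gap_of_mem_room {τ : ℝ} (hτ : 1 ≤ τ) {i : ℕ} {q : Evec 2} (h : q ∈ room τ i)
    (hq : q 1 ≤ 0) : |q 0 - roomX i| < gapH τ i ∧ |q 1| < gapH τ i := by
  rw [mem_room_iff hτ] at h
  have h1 := mul_nonneg (neg_nonneg.2 hq) (roomY_nonneg τ i)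
  constructor <;> refine abs_lt_of_sq_lt_sq ?_ (gapH_pos τ i).le <;>
    nlinarith [sq_nonneg (q 0 - roomX i), sq_nonneg (q 1)]

lemma snd_neg_of_mem_stadium {q : Evec 2} (h : q ∈ stadium) : q 1 < 0 := by
  obtain ⟨s, -, h⟩ := h
  have := (abs_snd_le_dist q (pt s (-1))).trans_lt h
  rw [pt_one, abs_lt] at this
  linarith

lemma mem_stadium_of {q : Evec 2} (h0 : |q 0| ≤ 1 / 2) (h1 : -1 ≤ q 1) (h2 : q 1 < 0) :
    q ∈ stadium := by
  refine ⟨q 0, h0, ?_⟩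
  rw [dist_lt_iff_sq one_pos]
  simp only [pt_zero, pt_one]
  nlinarith

lemma ball_subset_stadium {s : ℝ} (hs : |s| ≤ 1 / 2) : Metric.ball (pt s (-1)) 1 ⊆ stadium :=
  fun _ hq => ⟨s, hs, hq⟩

lemma isOpen_stadium : IsOpen stadium := by
  have : stadium = ⋃ s ∈ {s : ℝ | |s| ≤ 1 / 2}, Metric.ball (pt s (-1)) 1 := by
    ext q; simp [stadium]
  rw [this]
  exact isOpen_biUnion fun _ _ => Metric.isOpen_ball

lemma isOpen_roomsDom (τ : ℝ) : IsOpen (roomsDom τ) :=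
  isOpen_stadium.union (isOpen_iUnion fun _ => Metric.isOpen_ball)

lemma room_subset (τ : ℝ) (i : ℕ) : room τ i ⊆ roomsDom τ :=
  (subset_iUnion (room τ) i).trans subset_union_right

lemma stadium_subset (τ : ℝ) : stadium ⊆ roomsDom τ := subset_union_left

lemma roomX_add_abs_lt {i : ℕ} {x : ℝ} (h : |x - roomX i| ≤ 4 * roomR i) : |x| ≤ 5 / 16 := by
  have h1 := roomX_pos i
  have h2 := roomX_le i
  unfold roomR at h
  rw [abs_le] at h ⊢
  constructor <;> linarith

lemma wall_notMem {τ : ℝ} (hτ : 1 ≤ τ) {i : ℕ} {x : ℝ} (h1 : gapH τ i ≤ |x - roomX i|)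
    (h2 : |x - roomX i| ≤ 4 * roomR i) : pt x 0 ∉ roomsDom τ := by
  rintro (h | h)
  · simpa using snd_neg_of_mem_stadium h
  · obtain ⟨j, hj⟩ := mem_iUnion.1 h
    by_cases hij : i = j
    · subst hij
      have := (near_gap_of_mem_room hτ hj (by simp)).1
      rw [pt_zero] at this
      linarith
    · have h3 := abs_lt_roomR_of_mem_room hj
      have h4 := roomX_sep hij
      have h5 := abs_sub_le (roomX i) x (roomX j)
      rw [abs_sub_comm (roomX i) x] at h5
      rw [pt_zero] at h3
      linarith [roomR_pos j]

lemma ball_gap_subset {τ : ℝ} (hτ : 1 ≤ τ) (i : ℕ) :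
    Metric.ball (pt (roomX i) 0) (gapH τ i) ⊆ roomsDom τ := by
  intro q hq
  have h1 := (abs_fst_le_dist q _).trans_lt hq
  have h2 := (abs_snd_le_dist q _).trans_lt hq
  have hh := gapH_le hτ i
  have hr := roomR_le i
  have hr0 := roomR_pos i
  rw [pt_zero] at h1
  rw [pt_one, sub_zero, abs_lt] at h2
  rcases lt_or_ge (q 1) 0 with h | h
  · refine stadium_subset τ (mem_stadium_of ?_ (by linarith) h)
    have := roomX_add_abs_lt (by linarith : |q 0 - roomX i| ≤ 4 * roomR i)
    linarith
  · refine room_subset τ i ((mem_room_iff hτ).2 ?_)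
    rw [Metric.mem_ball, dist_lt_iff_sq (gapH_pos τ i)] at hq
    simp only [pt_zero, pt_one, sub_zero] at hq
    nlinarith [mul_nonneg h (roomY_nonneg τ i)]

lemma gap_mem_closedBall {τ : ℝ} (hτ : 1 ≤ τ) (i : ℕ) :
    dist (pt (roomX i) 0) (pt (roomX i) (roomY τ i)) ≤ roomR i := by
  rw [dist_le_iff_sq (roomR_pos i).le]
  have := roomY_le hτ i
  simp only [pt_zero, pt_one]
  nlinarith [roomY_nonneg τ i]

lemma roomsDom_ne_univ {τ : ℝ} (hτ : 1 ≤ τ) : roomsDom τ ≠ univ := by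
  intro h
  have hw := wall_notMem hτ (i := 0) (x := roomX 0 + roomR 0)
    (by rw [add_sub_cancel_left, abs_of_pos (roomR_pos 0)]; exact gapH_le hτ 0)
    (by rw [add_sub_cancel_left, abs_of_pos (roomR_pos 0)]; linarith [roomR_pos 0])
  exact hw (h ▸ mem_univ _)

lemma base_mem (τ : ℝ) : pt 0 (-1) ∈ roomsDom τ :=
  stadium_subset τ ⟨0, by norm_num, by simp⟩

lemma frontier_roomsDom_nonempty {τ : ℝ} (hτ : 1 ≤ τ) : (frontier (roomsDom τ)).Nonempty :=
  nonempty_frontier_iff.2 ⟨⟨_, base_mem τ⟩, roomsDom_ne_univ hτ⟩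

lemma coord_bound {τ : ℝ} (hτ : 1 ≤ τ) {q : Evec 2} (hq : q ∈ roomsDom τ) :
    |q 0| ≤ 2 ∧ |q 1| ≤ 2 := by
  rcases hq with ⟨s, hs, hq⟩ | hq
  · have h1 := (abs_fst_le_dist q _).trans_lt hq
    have h2 := (abs_snd_le_dist q _).trans_lt hq
    rw [pt_zero, abs_lt] at h1
    rw [pt_one, abs_lt] at h2
    rw [abs_le] at hs
    constructor <;> rw [abs_le] <;> constructor <;> linarith
  · obtain ⟨i, hi⟩ := mem_iUnion.1 hq
    have h1 := abs_lt_roomR_of_mem_room hi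
    have h2 := abs_snd_lt_of_mem_room hτ hi
    have h3 := roomX_add_abs_lt (by linarith [roomR_pos i] : |q 0 - roomX i| ≤ 4 * roomR i)
    have := roomR_le i
    constructor <;> linarith

lemma roomsDom_bounded {τ : ℝ} (hτ : 1 ≤ τ) : Bornology.IsBounded (roomsDom τ) := by
  refine (Metric.isBounded_ball (x := pt 0 0) (r := 5)).subset fun q hq => ?_
  have h := coord_bound hτ hq
  have h1 := dist_le_abs_add_abs q (pt 0 0)
  simp only [pt_zero, pt_one, sub_zero] at h1
  rw [Metric.mem_ball]
  linarith

/-- Points near the `i`-th opening are close to the boundary. -/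
lemma bdist_le_of_near {τ : ℝ} (hτ : 1 ≤ τ) {i : ℕ} {q : Evec 2} (hq : q ∈ roomsDom τ) {t : ℝ}
    (h0 : |q 0 - roomX i| ≤ t) (h1 : |q 1| ≤ t) : bdist (roomsDom τ) q ≤ 2 * t + roomR i := by
  have hr := roomR_pos i
  have hw := wall_notMem hτ (i := i) (x := roomX i + roomR i)
    (by rw [add_sub_cancel_left, abs_of_pos hr]; exact gapH_le hτ i)
    (by rw [add_sub_cancel_left, abs_of_pos hr]; linarith)
  refine (bdist_le_dist hq hw).trans ((dist_le_abs_add_abs _ _).trans ?_)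
  simp only [pt_zero, pt_one, sub_zero]
  have : |q 0 - (roomX i + roomR i)| ≤ |q 0 - roomX i| + roomR i := by
    rw [abs_le] at *
    constructor <;> linarith [neg_abs_le (q 0 - roomX i), le_abs_self (q 0 - roomX i)]
  linarith

lemma bdist_room_le {τ : ℝ} (hτ : 1 ≤ τ) {i : ℕ} {q : Evec 2} (hq : q ∈ room τ i) :
    bdist (roomsDom τ) q ≤ 5 * roomR i := by
  have := bdist_le_of_near hτ (room_subset τ i hq) (t := 2 * roomR i)
    (by linarith [abs_lt_roomR_of_mem_room hq, roomR_pos i]) (abs_snd_lt_of_mem_room hτ hq).le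
  linarith

lemma bdist_roomsDom_le {τ : ℝ} (hτ : 1 ≤ τ) {q : Evec 2} (hq : q ∈ roomsDom τ) :
    bdist (roomsDom τ) q ≤ 7 := by
  have h := coord_bound hτ hq
  have h1 := roomX_pos 0
  have h2 := roomX_le 0
  have := bdist_le_of_near hτ hq (i := 0) (t := 3)
    (by have := h.1; rw [abs_le] at *; constructor <;> linarith) (by linarith)
  linarith [roomR_le 0]

lemma bdist_base {τ : ℝ} (hτ : 1 ≤ τ) : 1 ≤ bdist (roomsDom τ) (pt 0 (-1)) :=
  le_bdist_of_ball_subset (isOpen_roomsDom τ) (frontier_roomsDom_nonempty hτ)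
    ((ball_subset_stadium (by norm_num)).trans (stadium_subset τ))

lemma abs_snd_le_bdist {τ : ℝ} (hτ : 1 ≤ τ) {i : ℕ} {q : Evec 2}
    (h0 : |q 0 - roomX i| ≤ 2 * gapH τ i) (h1 : -(2 * gapH τ i) ≤ q 1) (h2 : q 1 < 0) :
    -q 1 ≤ bdist (roomsDom τ) q := by
  refine le_bdist_of_ball_subset (isOpen_roomsDom τ) (frontier_roomsDom_nonempty hτ)
    fun w hw => stadium_subset τ ?_
  have e0 := (abs_fst_le_dist w q).trans_lt hw
  have e1 := (abs_snd_le_dist w q).trans_lt hw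
  have hh := gapH_le hτ i
  have hr := roomR_le i
  have hx := roomX_add_abs_lt (by linarith : |q 0 - roomX i| ≤ 4 * roomR i)
  rw [abs_lt] at e1 e0
  rw [abs_le] at hx
  refine mem_stadium_of ?_ (by linarith) (by linarith)
  rw [abs_le]
  constructor <;> linarith

lemma bdist_le_three_mul {τ : ℝ} (hτ : 1 ≤ τ) {i : ℕ} {q : Evec 2} (hq : q ∈ roomsDom τ)
    (h0 : |q 0 - roomX i| ≤ 2 * gapH τ i) (h2 : q 1 < 0)
    (hne : gapH τ i ≤ |q 0 - roomX i| ∨ gapH τ i ≤ -q 1) :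
    bdist (roomsDom τ) q ≤ 3 * -q 1 := by
  have hh := gapH_le hτ i
  have hh0 := gapH_pos τ i
  rcases le_or_gt (gapH τ i) |q 0 - roomX i| with h | h
  · refine (bdist_le_dist hq (wall_notMem hτ h (by linarith))).trans
      ((dist_le_abs_add_abs _ _).trans ?_)
    simp only [pt_zero, pt_one, sub_zero, sub_self, abs_zero, abs_of_neg h2]
    linarith
  · have h3 := hne.resolve_left (not_le.2 h)
    have hw := wall_notMem hτ (i := i) (x := roomX i + gapH τ i)
      (by rw [add_sub_cancel_left, abs_of_pos hh0])
      (by rw [add_sub_cancel_left, abs_of_pos hh0]; linarith)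
    refine (bdist_le_dist hq hw).trans ((dist_le_abs_add_abs _ _).trans ?_)
    simp only [pt_zero, pt_one, sub_zero, abs_of_neg h2]
    have : |q 0 - (roomX i + gapH τ i)| ≤ 2 * gapH τ i := by
      rw [abs_lt] at h
      rw [abs_le]
      constructor <;> linarith
    linarith

lemma log_segment_le {L s A : ℝ} (hL : 0 ≤ L) (hs : 0 < s) (h : L + s ≤ A) :
    Real.log ((L + s) / s) + 2 ≤ Real.log A - Real.log s + 2 ∧
      0 ≤ Real.log ((L + s) / s) + 2 := by
  constructor
  · rw [Real.log_div (by linarith) hs.ne']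
    have := Real.log_le_log (by linarith) h
    linarith
  · have : 0 ≤ Real.log ((L + s) / s) := Real.log_nonneg (by rw [le_div_iff₀ hs]; linarith)
    linarith

lemma stadium_qhJoin {τ : ℝ} (hτ : 1 ≤ τ) {x : Evec 2} {s u : ℝ} (hu : |u| ≤ 1 / 2)
    (hx : dist x (pt u (-1)) ≤ 1) (hs : 0 < s) (hs8 : s ≤ 7)
    (hball : Metric.ball x (2 * s) ⊆ roomsDom τ) :
    0 ≤ Real.log 8 - Real.log s + Real.log 4 + 4 ∧
    QHJoin (roomsDom τ) x (pt 0 (-1)) (Real.log 8 - Real.log s + Real.log 4 + 4) := by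
  have hΩ := isOpen_roomsDom τ
  have hf := frontier_roomsDom_nonempty hτ
  have hsub : ∀ {v : ℝ}, |v| ≤ 1 / 2 → Metric.ball (pt v (-1)) 1 ⊆ roomsDom τ :=
    fun hv => (ball_subset_stadium hv).trans (stadium_subset τ)
  have j1 := qhJoin_center hΩ hf (hsub hu) hx hs hball
  have b1 := log_segment_le (A := 8) (L := dist x (pt u (-1))) dist_nonneg hs (by linarith)
  have hd : dist (pt u (-1)) (pt 0 (-1)) ≤ 1 := by
    refine (dist_le_abs_add_abs _ _).trans ?_
    simp only [pt_zero, pt_one, sub_self, abs_zero, sub_zero]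
    linarith
  have j2 := qhJoin_center hΩ hf (hsub (v := 0) (by norm_num)) hd
    (by norm_num : (0:ℝ) < 1 / 2) (by simpa using hsub hu)
  have b2 := log_segment_le (A := 2) (L := dist (pt u (-1)) (pt 0 (-1))) dist_nonneg
    (by norm_num : (0:ℝ) < 1 / 2) (by linarith)
  have h4 : Real.log 4 = Real.log 2 - Real.log (1 / 2) := by
    rw [← Real.log_div (by norm_num) (by norm_num)]; norm_num
  exact ⟨by linarith, (j1.trans j2 b1.2 b2.2).mono (by linarith)⟩

lemma room_qhJoin {τ : ℝ} (hτ : 1 ≤ τ) {i : ℕ} {x : Evec 2} (hx : x ∈ room τ i) :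
    QHJoin (roomsDom τ) x (pt 0 (-1))
      (-Real.log (bdist (roomsDom τ) x) + (2 - 2 * τ) * Real.log (roomR i) +
        (3 * Real.log 2 + 3 * Real.log 8 + Real.log 4 + 8)) := by
  have hΩ := isOpen_roomsDom τ
  have hf := frontier_roomsDom_nonempty hτ
  have hxΩ := room_subset τ i hx
  have hρ := bdist_pos hΩ hf hxΩ
  have hρr := bdist_room_le hτ hx
  have hr := roomR_pos i
  have hh := gapH_pos τ i
  have hhr := gapH_le hτ i
  have hr1 := roomR_le i
  have j1 := qhJoin_center hΩ hf (room_subset τ i) (le_of_lt hx) (half_pos hρ)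
    (by rw [mul_div_cancel₀ _ two_ne_zero]; exact ball_bdist_subset hxΩ)
  have hx' : dist x (pt (roomX i) (roomY τ i)) ≤ roomR i := le_of_lt hx
  have b1 := log_segment_le (A := 8 * roomR i) (L := dist x (pt (roomX i) (roomY τ i)))
    dist_nonneg (half_pos hρ) (by linarith)
  have hb : Metric.ball (pt (roomX i) 0) (2 * (gapH τ i / 2)) ⊆ roomsDom τ := by
    rw [mul_div_cancel₀ _ two_ne_zero]; exact ball_gap_subset hτ i
  have hg := gap_mem_closedBall hτ i
  have j2 := (qhJoin_center hΩ hf (room_subset τ i) hg (half_pos hh) hb).symm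
  have b2 := log_segment_le (A := 8 * roomR i)
    (L := dist (pt (roomX i) 0) (pt (roomX i) (roomY τ i))) dist_nonneg (half_pos hh) (by linarith)
  obtain ⟨b3, j3⟩ := stadium_qhJoin hτ (x := pt (roomX i) 0) (u := roomX i)
    (by rw [abs_of_pos (roomX_pos i)]; linarith [roomX_le i])
    (by refine (dist_le_abs_add_abs _ _).trans ?_; simp) (half_pos hh) (by linarith) hb
  refine ((j1.trans j2 b1.2 b2.2).trans j3 (add_nonneg b1.2 b2.2) b3).mono ?_
  have e1 := b1.1
  have e2 := b2.1
  rw [Real.log_div hρ.ne' two_ne_zero, Real.log_mul (by norm_num) hr.ne'] at e1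
  have e3 : Real.log (gapH τ i / 2) = τ * Real.log (roomR i) - Real.log 2 := by
    rw [Real.log_div hh.ne' two_ne_zero, gapH, Real.log_rpow hr]
  rw [e3, Real.log_mul (by norm_num) hr.ne'] at e2
  rw [e3]
  linarith

lemma qhbc_roomsDom {β : ℝ} (hβ0 : 0 < β) (hβ : β ≤ 1) :
    QHBC (roomsDom ((1 + β) / (2 * β))) β := by
  set τ := (1 + β) / (2 * β) with hτdef
  have hτ : 1 ≤ τ := by rw [hτdef, le_div_iff₀ (by positivity)]; linarith
  have hτ2 : 2 - 2 * τ = 1 - 1 / β := by rw [hτdef]; field_simp; ring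
  have hβ1 : 0 ≤ 1 / β - 1 := by rw [sub_nonneg, le_div_iff₀ hβ0]; linarith
  have hΩ := isOpen_roomsDom τ
  have hf := frontier_roomsDom_nonempty hτ
  set K : ℝ := 4 * Real.log 2 + 3 * Real.log 8 + Real.log 4 + 8 with hK
  have l2 : 0 < Real.log 2 := Real.log_pos (by norm_num)
  have l4 : 0 < Real.log 4 := Real.log_pos (by norm_num)
  have l7 : 0 < Real.log 7 := Real.log_pos (by norm_num)
  have l8 : 0 < Real.log 8 := Real.log_pos (by norm_num)
  refine ⟨pt 0 (-1), base_mem τ, K + (1 / β - 1) * Real.log 7, fun x hx ε hε => ?_⟩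
  have hρ := bdist_pos hΩ hf hx
  have hρ7 := bdist_roomsDom_le hτ hx
  have h0 := bdist_base hτ
  have hl : Real.log (bdist (roomsDom τ) (pt 0 (-1)) / bdist (roomsDom τ) x) ≥
      -Real.log (bdist (roomsDom τ) x) := by
    rw [Real.log_div (by linarith) hρ.ne']
    linarith [Real.log_nonneg h0]
  have key : QHJoin (roomsDom τ) x (pt 0 (-1)) ((1 / β) * -Real.log (bdist (roomsDom τ) x) +
      (K + (1 / β - 1) * Real.log 7)) := by
    rcases hx with hx | hx'
    · obtain ⟨s, hs, hxs⟩ := hx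
      have hx := hρ
      obtain ⟨-, j⟩ := stadium_qhJoin hτ hs hxs.le (half_pos hρ) (by linarith)
        (by rw [mul_div_cancel₀ _ two_ne_zero]
            exact ball_bdist_subset (stadium_subset τ ⟨s, hs, hxs⟩))
      refine j.mono ?_
      rw [Real.log_div hρ.ne' two_ne_zero]
      have := mul_nonneg hβ1 (sub_nonneg.2 (Real.log_le_log hρ hρ7))
      simp only [hK]
      nlinarith
    · obtain ⟨i, hi⟩ := mem_iUnion.1 hx'
      refine (room_qhJoin hτ hi).mono ?_
      rw [hτ2]
      have h5 := Real.log_le_log hρ (bdist_room_le hτ hi)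
      rw [Real.log_mul (by norm_num) (roomR_pos i).ne'] at h5
      have h57 : Real.log 5 ≤ Real.log 7 := Real.log_le_log (by norm_num) (by norm_num)
      have := mul_nonneg hβ1 (by linarith :
        0 ≤ Real.log 7 + Real.log (roomR i) - Real.log (bdist (roomsDom τ) x))
      simp only [hK]
      nlinarith
  refine key.mono ?_
  have := mul_le_mul_of_nonneg_left hl (by positivity : 0 ≤ 1 / β)
  linarith

lemma isBoundedDomain_roomsDom {β : ℝ} (hβ0 : 0 < β) (hβ : β ≤ 1) :
    IsBoundedDomain (roomsDom ((1 + β) / (2 * β))) := by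
  have hτ : 1 ≤ (1 + β) / (2 * β) := by rw [le_div_iff₀ (by positivity)]; linarith
  refine ⟨isOpen_roomsDom _, IsPathConnected.isConnected ?_, roomsDom_bounded hτ⟩
  obtain ⟨x₀, h₀, C, h⟩ := qhbc_roomsDom hβ0 hβ
  refine ⟨x₀, h₀, fun {y} hy => JoinedIn.symm ?_⟩
  exact QHJoin.joinedIn (h y hy 1 one_pos)

/-- A compactly supported profile `F` equal to the identity near the origin, together with a
cutoff function `χ` and the derivatives of both. -/
structure CutoffProfile where
  /-- The profile. -/
  F : ℝ → ℝ
  /-- Its first derivative. -/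
  F' : ℝ → ℝ
  /-- Its second derivative. -/
  F'' : ℝ → ℝ
  /-- The cutoff function. -/
  χ : ℝ → ℝ
  /-- Its derivative. -/
  χ' : ℝ → ℝ
  /-- A common bound. -/
  K : ℝ
  K_pos : 0 < K
  hF : ∀ x, HasDerivAt F (F' x) x
  hF' : ∀ x, HasDerivAt F' (F'' x) x
  hχ : ∀ x, HasDerivAt χ (χ' x) x
  inner : ∀ x, |x| < 1 → F x = x ∧ F' x = 1 ∧ F'' x = 0 ∧ χ x = 1 ∧ χ' x = 0
  outer : ∀ x, 2 < |x| → F x = 0 ∧ F' x = 0 ∧ F'' x = 0 ∧ χ x = 0 ∧ χ' x = 0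
  bound : ∀ x, |F x| ≤ K ∧ |F' x| ≤ K ∧ |F'' x| ≤ K ∧ |χ x| ≤ K ∧ |χ' x| ≤ K

lemma CutoffProfile.nonempty : Nonempty CutoffProfile := by
  let φ : ContDiffBump (0:ℝ) := ⟨1, 2, one_pos, one_lt_two⟩
  have h1 : ∀ x, |x| < 1 → (φ : ℝ → ℝ) =ᶠ[𝓝 x] fun _ => 1 := fun x hx => by
    filter_upwards [(isOpen_lt continuous_abs continuous_const).mem_nhds hx] with y hy
    exact φ.one_of_mem_closedBall (by
      rw [Metric.mem_closedBall, Real.dist_eq, sub_zero]; exact le_of_lt hy)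
  have h2 : ∀ x, 2 < |x| → (φ : ℝ → ℝ) =ᶠ[𝓝 x] fun _ => 0 := fun x hx => by
    filter_upwards [(isOpen_lt continuous_const continuous_abs).mem_nhds hx] with y hy
    exact φ.zero_of_le_dist (by rw [Real.dist_eq, sub_zero]; exact le_of_lt hy)
  have hsm : ContDiff ℝ 2 (φ : ℝ → ℝ) := φ.contDiff
  have hsm' : ContDiff ℝ 1 (deriv (φ : ℝ → ℝ)) := by
    have : ContDiff ℝ (1 + 1) (φ : ℝ → ℝ) := by simpa [one_add_one_eq_two] using hsm
    exact (contDiff_succ_iff_deriv.1 this).2.2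
  have hd : ∀ x, HasDerivAt (φ : ℝ → ℝ) (deriv φ x) x := fun x =>
    (hsm.differentiable (by norm_num) x).hasDerivAt
  have hd' : ∀ x, HasDerivAt (deriv (φ : ℝ → ℝ)) (deriv (deriv φ) x) x := fun x =>
    (hsm'.differentiable (by norm_num) x).hasDerivAt
  have hc0 : Continuous (φ : ℝ → ℝ) := hsm.continuous
  have hc1 : Continuous (deriv (φ : ℝ → ℝ)) := hsm'.continuous
  have hc2 : Continuous (deriv (deriv (φ : ℝ → ℝ))) := hsm'.continuous_deriv le_rfl
  have hs0 : HasCompactSupport (φ : ℝ → ℝ) := φ.hasCompactSupport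
  have hs1 := hs0.deriv
  have hs2 := hs1.deriv
  obtain ⟨K1, hK1⟩ := (hs0.mul_left (f := fun x : ℝ => x)).exists_bound_of_continuous
    (continuous_id.mul hc0)
  obtain ⟨K2, hK2⟩ := (hs0.add (hs1.mul_left (f := fun x : ℝ => x))).exists_bound_of_continuous
    (hc0.add (continuous_id.mul hc1))
  obtain ⟨K3, hK3⟩ := ((hs1.add hs1).add
    (hs2.mul_left (f := fun x : ℝ => x))).exists_bound_of_continuous
    ((hc1.add hc1).add (continuous_id.mul hc2))
  obtain ⟨K4, hK4⟩ := hs0.exists_bound_of_continuous hc0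
  obtain ⟨K5, hK5⟩ := hs1.exists_bound_of_continuous hc1
  have p1 := (norm_nonneg _).trans (hK1 0)
  have p2 := (norm_nonneg _).trans (hK2 0)
  have p3 := (norm_nonneg _).trans (hK3 0)
  have p4 := (norm_nonneg _).trans (hK4 0)
  have p5 := (norm_nonneg _).trans (hK5 0)
  refine ⟨⟨fun x => x * φ x, fun x => φ x + x * deriv φ x,
    fun x => deriv φ x + deriv φ x + x * deriv (deriv φ) x, φ, deriv φ,
    K1 + K2 + K3 + K4 + K5 + 1, by linarith, ?_, ?_, hd, ?_, ?_, ?_⟩⟩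
  · intro x
    exact ((hasDerivAt_id' x).mul (hd x)).congr_deriv (by ring)
  · intro x
    exact ((hd x).add ((hasDerivAt_id' x).mul (hd' x))).congr_deriv (by ring)
  · intro x hx
    have e0 := (h1 x hx).eq_of_nhds
    have e1 : deriv φ x = 0 := by rw [(h1 x hx).deriv_eq]; simp
    have e2 : deriv (deriv φ) x = 0 := by rw [(h1 x hx).deriv.deriv_eq]; simp
    simp [e0, e1, e2]
  · intro x hx
    have e0 := (h2 x hx).eq_of_nhds
    have e1 : deriv φ x = 0 := by rw [(h2 x hx).deriv_eq]; simp
    have e2 : deriv (deriv φ) x = 0 := by rw [(h2 x hx).deriv.deriv_eq]; simp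
    simp [e0, e1, e2]
  · intro x
    have a1 : |x * φ x| ≤ K1 := hK1 x
    have a2 : |φ x + x * deriv φ x| ≤ K2 := hK2 x
    have a3 : |deriv φ x + deriv φ x + x * deriv (deriv φ) x| ≤ K3 := hK3 x
    have a4 : |φ x| ≤ K4 := hK4 x
    have a5 : |deriv φ x| ≤ K5 := hK5 x
    exact ⟨by linarith, by linarith, by linarith, by linarith, by linarith⟩

lemma pder_of_separable {v : Evec 2 → Evec 2} {q : Evec 2} {A₀ B₀ A₁ B₁ : ℝ → ℝ}
    {a₀ b₀ a₁ b₁ : ℝ} (hA₀ : HasDerivAt A₀ a₀ (q 0)) (hB₀ : HasDerivAt B₀ b₀ (q 1))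
    (hA₁ : HasDerivAt A₁ a₁ (q 0)) (hB₁ : HasDerivAt B₁ b₁ (q 1))
    (hv : v =ᶠ[𝓝 q] fun w => pt (A₀ (w 0) * B₀ (w 1)) (A₁ (w 0) * B₁ (w 1))) :
    DifferentiableAt ℝ v q ∧ pder v 0 0 q = a₀ * B₀ (q 1) ∧ pder v 0 1 q = A₀ (q 0) * b₀ ∧
      pder v 1 0 q = a₁ * B₁ (q 1) ∧ pder v 1 1 q = A₁ (q 0) * b₁ := by
  have hp : ∀ i : Fin 2, HasFDerivAt (fun w : Evec 2 => w i)
      (EuclideanSpace.proj i : Evec 2 →L[ℝ] ℝ) q := fun i =>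
    (EuclideanSpace.proj i : Evec 2 →L[ℝ] ℝ).hasFDerivAt
  have h0 : HasFDerivAt (fun w : Evec 2 => A₀ (w 0) * B₀ (w 1)) _ q :=
    (hA₀.comp_hasFDerivAt q (hp 0)).mul (hB₀.comp_hasFDerivAt q (hp 1))
  have h1 : HasFDerivAt (fun w : Evec 2 => A₁ (w 0) * B₁ (w 1)) _ q :=
    (hA₁.comp_hasFDerivAt q (hp 0)).mul (hB₁.comp_hasFDerivAt q (hp 1))
  have hd : DifferentiableAt ℝ v q := by
    refine DifferentiableAt.congr_of_eventuallyEq ?_ hv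
    rw [differentiableAt_euclidean]
    intro i
    fin_cases i
    · exact h0.differentiableAt
    · exact h1.differentiableAt
  have hc : ∀ i : Fin 2, HasFDerivAt (fun w => v w i)
      ((EuclideanSpace.proj i : Evec 2 →L[ℝ] ℝ).comp (fderiv ℝ v q)) q := fun i =>
    ((EuclideanSpace.proj i : Evec 2 →L[ℝ] ℝ).hasFDerivAt).comp q hd.hasFDerivAt
  have e0 := (hc 0).unique (h0.congr_of_eventuallyEq (hv.mono fun w hw => by simp [hw]))
  have e1 := (hc 1).unique (h1.congr_of_eventuallyEq (hv.mono fun w hw => by simp [hw]))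
  have k0 : ∀ j, pder v 0 j q = _ := fun j => congrArg (fun L => L (EuclideanSpace.single j 1)) e0
  have k1 : ∀ j, pder v 1 j q = _ := fun j => congrArg (fun L => L (EuclideanSpace.single j 1)) e1
  refine ⟨hd, ?_, ?_, ?_, ?_⟩
  · rw [k0]; simp [mul_comm]
  · rw [k0]; simp [mul_comm]
  · rw [k1]; simp [mul_comm]
  · rw [k1]; simp [mul_comm]

lemma DvLen_le {v : Evec 2 → Evec 2} {q : Evec 2} {M : ℝ} (h00 : |pder v 0 0 q| ≤ M)
    (h01 : |pder v 0 1 q| ≤ M) (h10 : |pder v 1 0 q| ≤ M) (h11 : |pder v 1 1 q| ≤ M) :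
    DvLen v q ≤ 2 * M := by
  have hM := (abs_nonneg _).trans h00
  rw [DvLen, Real.sqrt_le_left (by linarith)]
  simp only [Fin.sum_univ_two]
  have := sq_le_sq' (abs_le.1 h00).1 (abs_le.1 h00).2
  have := sq_le_sq' (abs_le.1 h01).1 (abs_le.1 h01).2
  have := sq_le_sq' (abs_le.1 h10).1 (abs_le.1 h10).2
  have := sq_le_sq' (abs_le.1 h11).1 (abs_le.1 h11).2
  linarith

lemma epsLen_le {v : Evec 2 → Evec 2} {q : Evec 2} {M : ℝ} (h00 : |pder v 0 0 q| ≤ M)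
    (h01 : |pder v 0 1 q + pder v 1 0 q| ≤ M) (h11 : |pder v 1 1 q| ≤ M) :
    epsLen v q ≤ 2 * M := by
  have hM := (abs_nonneg _).trans h00
  rw [epsLen, Real.sqrt_le_left (by linarith)]
  simp only [Fin.sum_univ_two]
  have := sq_le_sq' (abs_le.1 h00).1 (abs_le.1 h00).2
  have := sq_le_sq' (abs_le.1 h01).1 (abs_le.1 h01).2
  have := sq_le_sq' (abs_le.1 h11).1 (abs_le.1 h11).2
  nlinarith

lemma norm_pt_le (a b : ℝ) : ‖pt a b‖ ≤ |a| + |b| := by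
  have := dist_le_abs_add_abs (pt a b) 0
  simpa using this

/-- The vector field which is an infinitesimal rotation about the `i`-th opening in the `i`-th
room and is bent off to zero in the stadium. -/
def bendField (P : CutoffProfile) (τ : ℝ) (i : ℕ) (q : Evec 2) : Evec 2 :=
  open scoped Classical in
  if q ∈ room τ i then pt (-(q 1)) (q 0 - roomX i)
  else if q 1 < 0 then
    pt (-P.F' ((q 0 - roomX i) / gapH τ i) * (q 1 * P.χ (q 1 / gapH τ i)))
      (gapH τ i * P.F ((q 0 - roomX i) / gapH τ i) * P.χ (q 1 / gapH τ i))
  else 0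

lemma bendField_of_mem_room {τ : ℝ} (P : CutoffProfile) (i : ℕ) {q : Evec 2} (hq : q ∈ room τ i) :
    bendField P τ i q = pt (-(q 1)) (q 0 - roomX i) := by
  rw [bendField, if_pos hq]

lemma bendField_of_neg {τ : ℝ} (P : CutoffProfile) (hτ : 1 ≤ τ) (i : ℕ)
    {q : Evec 2} (hq : q 1 < 0) :
    bendField P τ i q = pt (-P.F' ((q 0 - roomX i) / gapH τ i) * (q 1 * P.χ (q 1 / gapH τ i)))
      (gapH τ i * P.F ((q 0 - roomX i) / gapH τ i) * P.χ (q 1 / gapH τ i)) := by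
  by_cases h : q ∈ room τ i
  · have hh := gapH_pos τ i
    obtain ⟨h0, h1⟩ := near_gap_of_mem_room hτ h hq.le
    have e0 := P.inner ((q 0 - roomX i) / gapH τ i)
      (by rwa [abs_div, abs_of_pos hh, div_lt_one hh])
    have e1 := P.inner (q 1 / gapH τ i) (by rwa [abs_div, abs_of_pos hh, div_lt_one hh])
    rw [bendField_of_mem_room P i h, e0.1, e0.2.1, e1.2.2.2.1]
    congr 1
    · ring
    · field_simp
  · rw [bendField, if_neg h, if_pos hq]

lemma bendField_of_mem_room_ne {τ : ℝ} (P : CutoffProfile) (hτ : 1 ≤ τ) (i : ℕ) {j : ℕ}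
    (hij : i ≠ j) {q : Evec 2} (hq : q ∈ room τ j) :
    bendField P τ i q = 0 := by
  have h3 := abs_lt_roomR_of_mem_room hq
  have h4 := roomX_sep hij
  have h5 := abs_sub_le (roomX i) (q 0) (roomX j)
  rw [abs_sub_comm (roomX i) (q 0)] at h5
  have hi := roomR_pos i
  have hj := roomR_pos j
  have hh := gapH_pos τ i
  have hhr := gapH_le hτ i
  by_cases h1 : q 1 < 0
  · have e0 := P.outer ((q 0 - roomX i) / gapH τ i)
      (by rw [abs_div, abs_of_pos hh, lt_div_iff₀ hh]; linarith)
    rw [bendField_of_neg P hτ i h1, e0.1, e0.2.1]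
    ext k; fin_cases k <;> simp
  · have h : q ∉ room τ i := fun h => by
      have := abs_lt_roomR_of_mem_room h
      linarith
    rw [bendField, if_neg h, if_neg h1]

lemma pder_bendField_room {τ : ℝ} (P : CutoffProfile) (i : ℕ) {q : Evec 2} (hq : q ∈ room τ i) :
    DifferentiableAt ℝ (bendField P τ i) q ∧ pder (bendField P τ i) 0 0 q = 0 ∧
      pder (bendField P τ i) 0 1 q = -1 ∧ pder (bendField P τ i) 1 0 q = 1 ∧
      pder (bendField P τ i) 1 1 q = 0 := by
  have hv : bendField P τ i =ᶠ[𝓝 q] fun w =>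
      pt ((fun _ => (1:ℝ)) (w 0) * (fun y : ℝ => -y) (w 1))
        ((fun x : ℝ => x - roomX i) (w 0) * (fun _ => (1:ℝ)) (w 1)) := by
    filter_upwards [Metric.isOpen_ball.mem_nhds hq] with w hw
    rw [bendField_of_mem_room P i hw]
    simp
  have := pder_of_separable (hasDerivAt_const _ _) (hasDerivAt_neg _)
    ((hasDerivAt_id' (q 0)).sub_const (roomX i)) (hasDerivAt_const _ _) hv
  simpa using this

lemma pder_bendField_room_ne {τ : ℝ} (P : CutoffProfile) (hτ : 1 ≤ τ) (i : ℕ) {j : ℕ}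
    (hij : i ≠ j) {q : Evec 2} (hq : q ∈ room τ j) :
    DifferentiableAt ℝ (bendField P τ i) q ∧ pder (bendField P τ i) 0 0 q = 0 ∧
      pder (bendField P τ i) 0 1 q = 0 ∧ pder (bendField P τ i) 1 0 q = 0 ∧
      pder (bendField P τ i) 1 1 q = 0 := by
  have hv : bendField P τ i =ᶠ[𝓝 q] fun w =>
      pt ((fun _ => (0:ℝ)) (w 0) * (fun _ => (0:ℝ)) (w 1))
        ((fun _ => (0:ℝ)) (w 0) * (fun _ => (0:ℝ)) (w 1)) := by
    filter_upwards [Metric.isOpen_ball.mem_nhds hq] with w hw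
    rw [bendField_of_mem_room_ne P hτ i hij hw]
    ext k; fin_cases k <;> simp
  have := pder_of_separable (hasDerivAt_const _ _) (hasDerivAt_const _ _)
    (hasDerivAt_const _ _) (hasDerivAt_const _ _) hv
  simpa using this

lemma pder_bendField_neg {τ : ℝ} (P : CutoffProfile) (hτ : 1 ≤ τ) (i : ℕ)
    {q : Evec 2} (hq : q 1 < 0) :
    DifferentiableAt ℝ (bendField P τ i) q ∧
      pder (bendField P τ i) 0 0 q =
        -(P.F'' ((q 0 - roomX i) / gapH τ i) * (q 1 / gapH τ i * P.χ (q 1 / gapH τ i))) ∧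
      pder (bendField P τ i) 0 1 q = -(P.F' ((q 0 - roomX i) / gapH τ i) *
        (P.χ (q 1 / gapH τ i) + q 1 / gapH τ i * P.χ' (q 1 / gapH τ i))) ∧
      pder (bendField P τ i) 1 0 q =
        P.F' ((q 0 - roomX i) / gapH τ i) * P.χ (q 1 / gapH τ i) ∧
      pder (bendField P τ i) 1 1 q =
        P.F ((q 0 - roomX i) / gapH τ i) * P.χ' (q 1 / gapH τ i) := by
  have hh := gapH_pos τ i
  set h := gapH τ i
  have hv : bendField P τ i =ᶠ[𝓝 q] fun w =>
      pt ((fun x : ℝ => -P.F' ((x - roomX i) / h)) (w 0) *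
          (fun y : ℝ => y * P.χ (y / h)) (w 1))
        ((fun x : ℝ => h * P.F ((x - roomX i) / h)) (w 0) *
          (fun y : ℝ => P.χ (y / h)) (w 1)) := by
    have hopen : IsOpen {w : Evec 2 | w 1 < 0} :=
      isOpen_lt (EuclideanSpace.proj (1 : Fin 2) : Evec 2 →L[ℝ] ℝ).continuous continuous_const
    filter_upwards [hopen.mem_nhds hq] with w hw
    exact bendField_of_neg P hτ i hw
  have dX : HasDerivAt (fun x : ℝ => (x - roomX i) / h) (1 / h) (q 0) :=
    ((hasDerivAt_id' (q 0)).sub_const (roomX i)).div_const h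
  have dY : HasDerivAt (fun y : ℝ => y / h) (1 / h) (q 1) := (hasDerivAt_id' (q 1)).div_const h
  have dχ : HasDerivAt (fun y : ℝ => P.χ (y / h)) (P.χ' (q 1 / h) * (1 / h)) (q 1) :=
    (P.hχ _).comp (q 1) dY
  have dA₀ : HasDerivAt (fun x : ℝ => -P.F' ((x - roomX i) / h))
      (-(P.F'' ((q 0 - roomX i) / h) * (1 / h))) (q 0) := ((P.hF' _).comp (q 0) dX).neg
  have dA₁ : HasDerivAt (fun x : ℝ => h * P.F ((x - roomX i) / h))
      (h * (P.F' ((q 0 - roomX i) / h) * (1 / h))) (q 0) := ((P.hF _).comp (q 0) dX).const_mul h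
  have dB₀ : HasDerivAt (fun y : ℝ => y * P.χ (y / h))
      (1 * P.χ (q 1 / h) + q 1 * (P.χ' (q 1 / h) * (1 / h))) (q 1) :=
    (hasDerivAt_id' (q 1)).mul dχ
  obtain ⟨e, e0, e1, e2, e3⟩ := pder_of_separable dA₀ dB₀ dA₁ dχ hv
  refine ⟨e, e0.trans ?_, e1.trans ?_, e2.trans ?_, e3.trans ?_⟩
  · ring
  · ring
  · field_simp
  · field_simp

lemma bendField_differentiableOn {τ : ℝ} (P : CutoffProfile) (hτ : 1 ≤ τ) (i : ℕ) :
    DifferentiableOn ℝ (bendField P τ i) (roomsDom τ) := by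
  rintro q (hq | hq)
  · exact (pder_bendField_neg P hτ i (snd_neg_of_mem_stadium hq)).1.differentiableWithinAt
  · obtain ⟨j, hj⟩ := mem_iUnion.1 hq
    by_cases hij : i = j
    · subst hij
      exact (pder_bendField_room P i hj).1.differentiableWithinAt
    · exact (pder_bendField_room_ne P hτ i hij hj).1.differentiableWithinAt

lemma CutoffProfile.abs_mul_χ_le (P : CutoffProfile) (y : ℝ) :
    |y * P.χ y| ≤ 2 * P.K ∧ |y * P.χ' y| ≤ 2 * P.K := by
  rcases lt_or_ge 2 |y| with h | h
  · obtain ⟨-, -, -, h1, h2⟩ := P.outer y h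
    have := P.K_pos
    rw [h1, h2]
    simp only [mul_zero, abs_zero]
    constructor <;> linarith
  · obtain ⟨-, -, -, h1, h2⟩ := P.bound y
    rw [abs_mul, abs_mul]
    exact ⟨mul_le_mul h h1 (abs_nonneg _) zero_le_two,
      mul_le_mul h h2 (abs_nonneg _) zero_le_two⟩

lemma CutoffProfile.abs_χ'_le (P : CutoffProfile) (y : ℝ) : |P.χ' y| ≤ P.K * |y| := by
  rcases lt_or_ge |y| 1 with h | h
  · rw [(P.inner y h).2.2.2.2, abs_zero]
    exact mul_nonneg P.K_pos.le (abs_nonneg _)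
  · exact (P.bound y).2.2.2.2.trans (le_mul_of_one_le_right P.K_pos.le h)

lemma DvLen_bendField_le {τ : ℝ} (P : CutoffProfile) (hτ : 1 ≤ τ) (i : ℕ)
    {q : Evec 2} (hq : q ∈ roomsDom τ) :
    DvLen (bendField P τ i) q ≤ 2 * (3 * P.K ^ 2 + 1) := by
  have hK := P.K_pos
  rcases hq with hq | hq
  · obtain ⟨-, e0, e1, e2, e3⟩ := pder_bendField_neg P hτ i (snd_neg_of_mem_stadium hq)
    generalize (q 0 - roomX i) / gapH τ i = X at *
    generalize q 1 / gapH τ i = Y at *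
    obtain ⟨b1, b2, b3, -, -⟩ := P.bound X
    obtain ⟨-, -, -, c1, c2⟩ := P.bound Y
    obtain ⟨d1, d2⟩ := P.abs_mul_χ_le Y
    refine DvLen_le ?_ ?_ ?_ ?_
    · rw [e0, abs_neg, abs_mul]
      have := mul_le_mul b3 d1 (abs_nonneg _) hK.le
      nlinarith
    · rw [e1, abs_neg, abs_mul]
      have := mul_le_mul b2 ((abs_add_le _ _).trans (add_le_add c1 d2)) (abs_nonneg _) hK.le
      nlinarith
    · rw [e2, abs_mul]
      have := mul_le_mul b2 c1 (abs_nonneg _) hK.le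
      nlinarith
    · rw [e3, abs_mul]
      have := mul_le_mul b1 c2 (abs_nonneg _) hK.le
      nlinarith
  · obtain ⟨j, hj⟩ := mem_iUnion.1 hq
    have h1 : (0:ℝ) ≤ 3 * P.K ^ 2 + 1 := by positivity
    have h2 : (1:ℝ) ≤ 3 * P.K ^ 2 + 1 := by nlinarith
    by_cases hij : i = j
    · subst hij
      obtain ⟨-, e0, e1, e2, e3⟩ := pder_bendField_room P i hj
      apply DvLen_le <;> simp only [e0, e1, e2, e3, abs_zero, abs_neg, abs_one, h1, h2]
    · obtain ⟨-, e0, e1, e2, e3⟩ := pder_bendField_room_ne P hτ i hij hj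
      apply DvLen_le <;> simp only [e0, e1, e2, e3, abs_zero, h1]

lemma one_le_DvLen_bendField {τ : ℝ} (P : CutoffProfile) (i : ℕ) {q : Evec 2} (hq : q ∈ room τ i) :
    1 ≤ DvLen (bendField P τ i) q := by
  obtain ⟨-, e0, e1, e2, e3⟩ := pder_bendField_room P i hq
  rw [DvLen, Real.one_le_sqrt]
  simp only [Fin.sum_univ_two, e0, e1, e2, e3]
  norm_num

/-- The strain of the bending field vanishes linearly at the wall and is concentrated near the
opening, away from the part of it where the field is a rotation. -/
lemma epsLen_bendField {τ : ℝ} (P : CutoffProfile) (hτ : 1 ≤ τ) (i : ℕ)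
    {q : Evec 2} (hq : q ∈ roomsDom τ) :
    epsLen (bendField P τ i) q = 0 ∨
      (|q 0 - roomX i| ≤ 2 * gapH τ i ∧ -(2 * gapH τ i) ≤ q 1 ∧ q 1 < 0 ∧
        (gapH τ i ≤ |q 0 - roomX i| ∨ gapH τ i ≤ -q 1) ∧
        epsLen (bendField P τ i) q ≤ 2 * P.K ^ 2 / gapH τ i * -q 1) := by
  have hK := P.K_pos
  have hh := gapH_pos τ i
  have hzero : pder (bendField P τ i) 0 0 q = 0 →
      pder (bendField P τ i) 0 1 q + pder (bendField P τ i) 1 0 q = 0 →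
      pder (bendField P τ i) 1 1 q = 0 → epsLen (bendField P τ i) q = 0 := fun h1 h2 h3 => by
    have h : epsLen (bendField P τ i) q ≤ 2 * 0 :=
      epsLen_le (by rw [h1, abs_zero]) (by rw [h2, abs_zero]) (by rw [h3, abs_zero])
    rw [mul_zero] at h
    exact le_antisymm h (Real.sqrt_nonneg _)
  rcases hq with hq | hq
  · have hneg := snd_neg_of_mem_stadium hq
    obtain ⟨-, e0, e1, e2, e3⟩ := pder_bendField_neg P hτ i hneg
    have hY : |q 1 / gapH τ i| = -q 1 / gapH τ i := by
      rw [abs_div, abs_of_neg hneg, abs_of_pos hh]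
    have hX : |(q 0 - roomX i) / gapH τ i| = |q 0 - roomX i| / gapH τ i := by
      rw [abs_div, abs_of_pos hh]
    have e12 : pder (bendField P τ i) 0 1 q + pder (bendField P τ i) 1 0 q =
        -(P.F' ((q 0 - roomX i) / gapH τ i) *
          (q 1 / gapH τ i * P.χ' (q 1 / gapH τ i))) := by
      rw [e1, e2]; ring
    rcases lt_or_ge (2 * gapH τ i) |q 0 - roomX i| with h0 | h0
    · left
      obtain ⟨o1, o2, o3, -, -⟩ := P.outer ((q 0 - roomX i) / gapH τ i)
        (by rw [hX, lt_div_iff₀ hh]; exact h0)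
      exact hzero (by rw [e0, o3]; ring) (by rw [e12, o2]; ring) (by rw [e3, o1]; ring)
    rcases lt_or_ge (q 1) (-(2 * gapH τ i)) with h1 | h1
    · left
      obtain ⟨-, -, -, o1, o2⟩ := P.outer (q 1 / gapH τ i)
        (by rw [hY, lt_div_iff₀ hh]; linarith)
      exact hzero (by rw [e0, o1]; ring) (by rw [e12, o2]; ring) (by rw [e3, o2]; ring)
    by_cases h2 : gapH τ i ≤ |q 0 - roomX i| ∨ gapH τ i ≤ -q 1
    · right
      refine ⟨h0, h1, hneg, h2, ?_⟩
      have : 2 * P.K ^ 2 / gapH τ i * -q 1 = 2 * (P.K ^ 2 * |q 1 / gapH τ i|) := by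
        rw [hY]; ring
      rw [this]
      generalize (q 0 - roomX i) / gapH τ i = X at *
      generalize q 1 / gapH τ i = Y at *
      obtain ⟨b1, b2, b3, -, -⟩ := P.bound X
      obtain ⟨-, -, -, c1, c2⟩ := P.bound Y
      have c3 := P.abs_χ'_le Y
      have hY0 := abs_nonneg Y
      refine epsLen_le ?_ ?_ ?_
      · rw [e0, abs_neg, abs_mul, abs_mul]
        have := mul_le_mul b3 (mul_le_mul_of_nonneg_left c1 hY0) (by positivity) hK.le
        linarith
      · rw [e12, abs_neg, abs_mul, abs_mul]
        have := mul_le_mul b2 (mul_le_mul_of_nonneg_left c2 hY0) (by positivity) hK.le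
        linarith
      · rw [e3, abs_mul]
        have := mul_le_mul b1 c3 (abs_nonneg _) hK.le
        linarith
    · left
      push Not at h2
      obtain ⟨-, -, o3, -, -⟩ := P.inner ((q 0 - roomX i) / gapH τ i)
        (by rw [hX, div_lt_one hh]; exact h2.1)
      obtain ⟨-, -, -, -, o4⟩ := P.inner (q 1 / gapH τ i)
        (by rw [hY, div_lt_one hh]; exact h2.2)
      exact hzero (by rw [e0, o3]; ring) (by rw [e12, o4]; ring) (by rw [e3, o4]; ring)
  · left
    obtain ⟨j, hj⟩ := mem_iUnion.1 hq
    by_cases hij : i = j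
    · subst hij
      obtain ⟨-, e0, e1, e2, e3⟩ := pder_bendField_room P i hj
      exact hzero e0 (by rw [e1, e2]; ring) e3
    · obtain ⟨-, e0, e1, e2, e3⟩ := pder_bendField_room_ne P hτ i hij hj
      exact hzero e0 (by rw [e1, e2]; ring) e3

lemma norm_bendField {τ : ℝ} (P : CutoffProfile) (hτ : 1 ≤ τ) (i : ℕ)
    {q : Evec 2} (hq : q ∈ roomsDom τ) :
    bendField P τ i q = 0 ∨ (|q 0 - roomX i| ≤ 2 * roomR i ∧ |q 1| ≤ 2 * roomR i ∧
      ‖bendField P τ i q‖ ≤ (3 * P.K ^ 2 + 3) * roomR i) := by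
  have hK := P.K_pos
  have hh := gapH_pos τ i
  have hr := roomR_pos i
  have hhr := gapH_le hτ i
  rcases hq with hq | hq
  · have hneg := snd_neg_of_mem_stadium hq
    have e := bendField_of_neg P hτ i hneg
    rcases lt_or_ge (2 * gapH τ i) |q 0 - roomX i| with h0 | h0
    · left
      have o := P.outer ((q 0 - roomX i) / gapH τ i)
        (by rw [abs_div, abs_of_pos hh, lt_div_iff₀ hh]; exact h0)
      rw [e, o.1, o.2.1]
      ext k; fin_cases k <;> simp
    rcases lt_or_ge (2 * gapH τ i) |q 1| with h1 | h1
    · left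
      have o := P.outer (q 1 / gapH τ i)
        (by rw [abs_div, abs_of_pos hh, lt_div_iff₀ hh]; exact h1)
      rw [e, o.2.2.2.1]
      ext k; fin_cases k <;> simp
    right
    refine ⟨by linarith, by linarith, ?_⟩
    rw [e]
    refine (norm_pt_le _ _).trans ?_
    have hq1 : q 1 = gapH τ i * (q 1 / gapH τ i) := by field_simp
    have b := P.bound ((q 0 - roomX i) / gapH τ i)
    have c := P.bound (q 1 / gapH τ i)
    have k1 : |-P.F' ((q 0 - roomX i) / gapH τ i) * (q 1 * P.χ (q 1 / gapH τ i))| ≤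
        P.K * (2 * roomR i * P.K) := by
      rw [abs_mul, abs_mul, abs_neg]
      exact mul_le_mul b.2.1 (mul_le_mul (by linarith) c.2.2.2.1 (abs_nonneg _) (by linarith))
        (by positivity) hK.le
    have k2 : |gapH τ i * P.F ((q 0 - roomX i) / gapH τ i) * P.χ (q 1 / gapH τ i)| ≤
        roomR i * P.K * P.K := by
      rw [abs_mul, abs_mul, abs_of_pos hh]
      exact mul_le_mul (mul_le_mul hhr b.1 (abs_nonneg _) hr.le) c.2.2.2.1 (abs_nonneg _)
        (by positivity)
    nlinarith
  · obtain ⟨j, hj⟩ := mem_iUnion.1 hq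
    by_cases hij : i = j
    · subst hij
      right
      have h0 := abs_lt_roomR_of_mem_room hj
      have h1 := abs_snd_lt_of_mem_room hτ hj
      refine ⟨by linarith, h1.le, ?_⟩
      rw [bendField_of_mem_room P i hj]
      refine (norm_pt_le _ _).trans ?_
      rw [abs_neg]
      nlinarith [mul_pos (pow_pos hK 2) hr]
    · exact Or.inl (bendField_of_mem_room_ne P hτ i hij hj)

lemma volume_preserving_coords :
    MeasurePreserving (fun q : Evec 2 => (q 0, q 1)) volume volume :=
  (volume_preserving_finTwoArrow ℝ).comp (PiLp.volume_preserving_ofLp (Fin 2))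

lemma lintegral_box {I J : Set ℝ} (hI : MeasurableSet I) (hJ : MeasurableSet J) {g : ℝ → ℝ≥0∞}
    (hg : Measurable g) :
    ∫⁻ q in {q : Evec 2 | q 0 ∈ I ∧ q 1 ∈ J}, g (q 1) = volume I * ∫⁻ y in J, g y := by
  have h := volume_preserving_coords.setLIntegral_comp_preimage (hI.prod hJ)
    (f := fun z : ℝ × ℝ => g z.2) (hg.comp measurable_snd)
  have hset : (fun q : Evec 2 => (q 0, q 1)) ⁻¹' I ×ˢ J = {q : Evec 2 | q 0 ∈ I ∧ q 1 ∈ J} := rfl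
  rw [hset] at h
  rw [h, Measure.volume_eq_prod, ← Measure.prod_restrict]
  have := lintegral_prod_mul (μ := (volume : Measure ℝ).restrict I)
    (ν := (volume : Measure ℝ).restrict J) (f := fun _ => 1) (g := g)
    aemeasurable_const hg.aemeasurable
  simpa using this

lemma measurableSet_box {I J : Set ℝ} (hI : MeasurableSet I) (hJ : MeasurableSet J) :
    MeasurableSet {q : Evec 2 | q 0 ∈ I ∧ q 1 ∈ J} :=
  volume_preserving_coords.measurable (hI.prod hJ)

lemma volume_box {I J : Set ℝ} (hI : MeasurableSet I) (hJ : MeasurableSet J) :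
    volume {q : Evec 2 | q 0 ∈ I ∧ q 1 ∈ J} = volume I * volume J := by
  simpa using lintegral_box hI hJ (g := fun _ => 1) measurable_const

lemma lintegral_neg_rpow {s L : ℝ} (hs : -1 < s) (hL : 0 < L) :
    ∫⁻ y in Ico (-L) 0, ENNReal.ofReal ((-y) ^ s) = ENNReal.ofReal (L ^ (s + 1) / (s + 1)) := by
  have h0 : Ico (-L) 0 = (fun y : ℝ => -y) ⁻¹' Ioc 0 L := by
    ext y; simp only [mem_Ico, mem_preimage, mem_Ioc]
    constructor <;> rintro ⟨h1, h2⟩ <;> constructor <;> linarith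
  rw [h0, (Measure.measurePreserving_neg (volume : Measure ℝ)).setLIntegral_comp_preimage
    measurableSet_Ioc (f := fun y => ENNReal.ofReal (y ^ s)) (by fun_prop)]
  have hi : IntegrableOn (fun y : ℝ => y ^ s) (Ioc 0 L) :=
    (intervalIntegrable_iff_integrableOn_Ioc_of_le hL.le).1
      (intervalIntegral.intervalIntegrable_rpow' hs)
  rw [← ofReal_integral_eq_lintegral_ofReal hi
    (by
      filter_upwards [ae_restrict_mem measurableSet_Ioc] with y hy
      exact Real.rpow_nonneg hy.1.le s),
    ← intervalIntegral.integral_of_le hL.le, integral_rpow (Or.inl hs),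
    Real.zero_rpow (by linarith), sub_zero]

lemma rpow_le_of_comparable {x y c : ℝ} (hx : 0 < x) (hxy : x ≤ y) (hyx : y ≤ c * x)
    (hc : 1 ≤ c) (s : ℝ) : y ^ s ≤ c ^ |s| * x ^ s := by
  rcases le_total 0 s with h | h
  · rw [abs_of_nonneg h, ← Real.mul_rpow (by linarith) hx.le]
    exact Real.rpow_le_rpow (by linarith) hyx h
  · have h1 : y ^ s ≤ x ^ s := Real.rpow_le_rpow_of_nonpos hx hxy h
    exact h1.trans (le_mul_of_one_le_left (Real.rpow_nonneg hx.le s)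
      (Real.one_le_rpow hc (abs_nonneg s)))

lemma epsLen_nonneg (v : Evec 2 → Evec 2) (q : Evec 2) : 0 ≤ epsLen v q := Real.sqrt_nonneg _

lemma DvLen_nonneg (v : Evec 2 → Evec 2) (q : Evec 2) : 0 ≤ DvLen v q := Real.sqrt_nonneg _

lemma bdist_nonneg (Ω : Set (Evec 2)) (q : Evec 2) : 0 ≤ bdist Ω q := Metric.infDist_nonneg

lemma wIp_epsLen_le {τ p B : ℝ} (P : CutoffProfile) (hτ : 1 ≤ τ) (hp : 0 < p)
    (i : ℕ) (hB : -1 < p + B) :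
    wIp (roomsDom τ) (roomsDom τ) p B (epsLen (bendField P τ i)) ≤
      ENNReal.ofReal ((2 * P.K ^ 2) ^ p * 3 ^ |B| * 4 * 2 ^ (p + B + 1) / (p + B + 1) *
        gapH τ i ^ (B + 2)) := by
  have hh := gapH_pos τ i
  have hK := P.K_pos
  set h := gapH τ i with hdef
  set c : ℝ := (2 * P.K ^ 2 / h) ^ p * 3 ^ |B| with hc
  have hc0 : 0 ≤ c := by positivity
  set T : Set (Evec 2) := {q : Evec 2 | q 0 ∈ Icc (roomX i - 2 * h) (roomX i + 2 * h) ∧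
    q 1 ∈ Ico (-(2 * h)) 0} with hT
  have hTm : MeasurableSet T := measurableSet_box measurableSet_Icc measurableSet_Ico
  have hpt : ∀ q ∈ roomsDom τ, ENNReal.ofReal (|epsLen (bendField P τ i) q| ^ p *
      bdist (roomsDom τ) q ^ B) ≤
      T.indicator (fun q => ENNReal.ofReal c * ENNReal.ofReal ((-q 1) ^ (p + B))) q := by
    intro q hq
    rcases epsLen_bendField P hτ i hq with h0 | ⟨h1, h2, h3, h4, h5⟩
    · rw [h0, abs_zero, Real.zero_rpow hp.ne', zero_mul, ENNReal.ofReal_zero]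
      exact zero_le
    · have hqT : q ∈ T := by
        rw [abs_le] at h1
        exact ⟨⟨by linarith [h1.1], by linarith [h1.2]⟩, h2, h3⟩
      rw [indicator_of_mem hqT, ← ENNReal.ofReal_mul hc0]
      refine ENNReal.ofReal_le_ofReal ?_
      have hy : 0 < -q 1 := by linarith
      have e1 : |epsLen (bendField P τ i) q| ^ p ≤ (2 * P.K ^ 2 / h) ^ p * (-q 1) ^ p := by
        rw [← Real.mul_rpow (by positivity) hy.le, abs_of_nonneg (epsLen_nonneg _ _)]
        exact Real.rpow_le_rpow (epsLen_nonneg _ _) h5 hp.le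
      have e2 := rpow_le_of_comparable hy (abs_snd_le_bdist hτ h1 h2 h3)
        (bdist_le_three_mul hτ hq h1 h3 h4) (by norm_num) B
      calc _ ≤ (2 * P.K ^ 2 / h) ^ p * (-q 1) ^ p * (3 ^ |B| * (-q 1) ^ B) :=
            mul_le_mul e1 e2 (Real.rpow_nonneg (bdist_nonneg _ _) _) (by positivity)
        _ = c * (-q 1) ^ (p + B) := by rw [Real.rpow_add hy, hc]; ring
  calc wIp (roomsDom τ) (roomsDom τ) p B (epsLen (bendField P τ i))
      ≤ ∫⁻ q in roomsDom τ,
          T.indicator (fun q => ENNReal.ofReal c * ENNReal.ofReal ((-q 1) ^ (p + B))) q :=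
        setLIntegral_mono' (isOpen_roomsDom τ).measurableSet hpt
    _ ≤ ∫⁻ q, T.indicator (fun q => ENNReal.ofReal c * ENNReal.ofReal ((-q 1) ^ (p + B))) q :=
        setLIntegral_le_lintegral _ _
    _ = ENNReal.ofReal (4 * h) *
        (ENNReal.ofReal c * ENNReal.ofReal ((2 * h) ^ (p + B + 1) / (p + B + 1))) := by
        rw [lintegral_indicator hTm, hT, lintegral_box measurableSet_Icc measurableSet_Ico
          (g := fun y => ENNReal.ofReal c * ENNReal.ofReal ((-y) ^ (p + B))) (by fun_prop),
          lintegral_const_mul _ (by fun_prop), lintegral_neg_rpow hB (by positivity),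
          Real.volume_Icc]
        congr 2
        ring
    _ = _ := by
        rw [← ENNReal.ofReal_mul hc0, ← ENNReal.ofReal_mul (by positivity)]
        congr 1
        rw [hc, Real.div_rpow (by positivity) hh.le, Real.mul_rpow zero_le_two hh.le,
          show p + B + 1 = p + (B + 2) - 1 by ring, Real.rpow_sub hh, Real.rpow_add hh,
          Real.rpow_one]
        field_simp

lemma wIp_norm_le {τ p a : ℝ} (P : CutoffProfile) (hτ : 1 ≤ τ) (hp : 0 < p) (ha : 0 ≤ a)
    (i : ℕ) :
    wIp (roomsDom τ) (roomsDom τ) p a (fun q => ‖bendField P τ i q‖) ≤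
      ENNReal.ofReal ((3 * P.K ^ 2 + 3) ^ p * 5 ^ a * 16 * roomR i ^ (p + a + 2)) := by
  have hr := roomR_pos i
  have hK := P.K_pos
  set r := roomR i with hdef
  set c : ℝ := ((3 * P.K ^ 2 + 3) * r) ^ p * (5 * r) ^ a with hc
  have hc0 : 0 ≤ c := by positivity
  set T : Set (Evec 2) := {q : Evec 2 | q 0 ∈ Icc (roomX i - 2 * r) (roomX i + 2 * r) ∧
    q 1 ∈ Icc (-(2 * r)) (2 * r)} with hT
  have hTm : MeasurableSet T := measurableSet_box measurableSet_Icc measurableSet_Icc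
  have hpt : ∀ q ∈ roomsDom τ, ENNReal.ofReal (|‖bendField P τ i q‖| ^ p *
      bdist (roomsDom τ) q ^ a) ≤ T.indicator (fun _ => ENNReal.ofReal c) q := by
    intro q hq
    rcases norm_bendField P hτ i hq with h0 | ⟨h1, h2, h3⟩
    · rw [h0, norm_zero, abs_zero, Real.zero_rpow hp.ne', zero_mul, ENNReal.ofReal_zero]
      exact zero_le
    · have h4 := bdist_le_of_near hτ hq h1 h2
      have hqT : q ∈ T := by
        rw [abs_le] at h1 h2
        exact ⟨⟨by linarith [h1.1], by linarith [h1.2]⟩, h2⟩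
      rw [indicator_of_mem hqT, abs_norm]
      refine ENNReal.ofReal_le_ofReal (mul_le_mul (Real.rpow_le_rpow (norm_nonneg _) h3 hp.le)
        (Real.rpow_le_rpow (bdist_nonneg _ _) (by linarith) ha)
        (Real.rpow_nonneg (bdist_nonneg _ _) _) (by positivity))
  calc wIp (roomsDom τ) (roomsDom τ) p a (fun q => ‖bendField P τ i q‖)
      ≤ ∫⁻ q in roomsDom τ, T.indicator (fun _ => ENNReal.ofReal c) q :=
        setLIntegral_mono' (isOpen_roomsDom τ).measurableSet hpt
    _ ≤ ∫⁻ q, T.indicator (fun _ => ENNReal.ofReal c) q := setLIntegral_le_lintegral _ _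
    _ = ENNReal.ofReal c * (ENNReal.ofReal (4 * r) * ENNReal.ofReal (4 * r)) := by
        rw [lintegral_indicator hTm, setLIntegral_const, hT,
          volume_box measurableSet_Icc measurableSet_Icc, Real.volume_Icc, Real.volume_Icc]
        congr 3 <;> ring
    _ = _ := by
        rw [← ENNReal.ofReal_mul (by positivity), ← ENNReal.ofReal_mul hc0]
        congr 1
        rw [hc, Real.mul_rpow (by positivity) hr.le, Real.mul_rpow (by positivity) hr.le,
          Real.rpow_add hr, Real.rpow_add hr, Real.rpow_two]
        ring

lemma le_wIp_DvLen {τ p a : ℝ} (P : CutoffProfile) (hτ : 1 ≤ τ) (hp : 0 < p) (ha : 0 ≤ a)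
    (i : ℕ) :
    ENNReal.ofReal ((1 / 2) ^ (a + 2) * roomR i ^ (a + 2)) ≤
      wIp (roomsDom τ) (roomsDom τ) p a (DvLen (bendField P τ i)) := by
  have hr := roomR_pos i
  set r := roomR i with hdef
  set T : Set (Evec 2) := {q : Evec 2 | q 0 ∈ Icc (roomX i - r / 4) (roomX i + r / 4) ∧
    q 1 ∈ Icc (roomY τ i - r / 4) (roomY τ i + r / 4)} with hT
  have hTm : MeasurableSet T := measurableSet_box measurableSet_Icc measurableSet_Icc
  have hdist : ∀ q ∈ T, dist q (pt (roomX i) (roomY τ i)) ≤ r / 2 := by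
    rintro q ⟨⟨h1, h2⟩, h3, h4⟩
    have h5 : |q 0 - roomX i| ≤ r / 4 := abs_le.2 ⟨by linarith, by linarith⟩
    have h6 : |q 1 - roomY τ i| ≤ r / 4 := abs_le.2 ⟨by linarith, by linarith⟩
    have h7 := dist_le_abs_add_abs q (pt (roomX i) (roomY τ i))
    rw [pt_zero, pt_one] at h7
    linarith
  have hroom : T ⊆ room τ i := fun q hq => Metric.mem_ball.2 (by
    have := hdist q hq
    linarith)
  have hpt : ∀ q ∈ T, ENNReal.ofReal ((r / 2) ^ a) ≤
      ENNReal.ofReal (|DvLen (bendField P τ i) q| ^ p * bdist (roomsDom τ) q ^ a) := by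
    intro q hq
    have h1 := one_le_DvLen_bendField P i (hroom hq)
    have h2 : r / 2 ≤ bdist (roomsDom τ) q := by
      refine le_bdist_of_ball_subset (isOpen_roomsDom τ) (frontier_roomsDom_nonempty hτ)
        ((Metric.ball_subset_ball' ?_).trans (room_subset τ i))
      have := hdist q hq
      linarith
    refine ENNReal.ofReal_le_ofReal ?_
    calc (r / 2) ^ a ≤ bdist (roomsDom τ) q ^ a := Real.rpow_le_rpow (by positivity) h2 ha
      _ ≤ _ := le_mul_of_one_le_left (Real.rpow_nonneg (bdist_nonneg _ _) _)
          (Real.one_le_rpow (h1.trans (le_abs_self _)) hp.le)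
  calc ENNReal.ofReal ((1 / 2) ^ (a + 2) * r ^ (a + 2))
      = ENNReal.ofReal ((r / 2) ^ a) * (ENNReal.ofReal (r / 2) * ENNReal.ofReal (r / 2)) := by
        rw [← ENNReal.ofReal_mul (by positivity), ← ENNReal.ofReal_mul (by positivity),
          ← Real.mul_rpow (by positivity) hr.le, Real.rpow_add (by positivity), Real.rpow_two]
        congr 1
        rw [show 1 / 2 * r = r / 2 by ring]
        ring
    _ = ∫⁻ _ in T, ENNReal.ofReal ((r / 2) ^ a) := by
        rw [setLIntegral_const, hT, volume_box measurableSet_Icc measurableSet_Icc,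
          Real.volume_Icc, Real.volume_Icc]
        congr 3 <;> ring
    _ ≤ ∫⁻ q in T, ENNReal.ofReal (|DvLen (bendField P τ i) q| ^ p * bdist (roomsDom τ) q ^ a) :=
        setLIntegral_mono' hTm hpt
    _ ≤ _ := lintegral_mono_set (hroom.trans (room_subset τ i))

lemma memW1Vec_bendField {τ p a : ℝ} (P : CutoffProfile) (hτ : 1 ≤ τ) (hp : 0 < p) (ha : 0 ≤ a)
    (i : ℕ) : MemW1Vec (roomsDom τ) p a a (bendField P τ i) := by
  refine ⟨bendField_differentiableOn P hτ i,
    (wIp_norm_le P hτ hp ha i).trans_lt ENNReal.ofReal_lt_top, ?_⟩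
  have hfin : volume (roomsDom τ) < ⊤ := (roomsDom_bounded hτ).measure_lt_top
  refine lt_of_le_of_lt (setLIntegral_mono' (isOpen_roomsDom τ).measurableSet
    (g := fun _ => ENNReal.ofReal ((2 * (3 * P.K ^ 2 + 1)) ^ p * 7 ^ a)) fun q hq => ?_) ?_
  · refine ENNReal.ofReal_le_ofReal (mul_le_mul (Real.rpow_le_rpow (abs_nonneg _) ?_ hp.le)
      (Real.rpow_le_rpow (bdist_nonneg _ _) (bdist_roomsDom_le hτ hq) ha)
      (Real.rpow_nonneg (bdist_nonneg _ _) _) (by positivity))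
    rw [abs_of_nonneg (DvLen_nonneg _ _)]
    exact DvLen_bendField_le P hτ i hq
  · rw [setLIntegral_const]
    exact ENNReal.mul_lt_top ENNReal.ofReal_lt_top hfin

lemma tendsto_roomR : Tendsto roomR atTop (𝓝 0) := by
  have h : Tendsto (fun i : ℕ => ((1:ℝ) / 2) ^ (i + 2) / 16) atTop (𝓝 (0 / 16)) :=
    ((tendsto_add_atTop_iff_nat 2).2
      (tendsto_pow_atTop_nhds_zero_of_lt_one (by norm_num) (by norm_num))).div_const 16
  rw [zero_div] at h
  exact h

/-- A power cannot be dominated by a sum of higher powers along the radii of the rooms. -/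
lemma not_forall_rpow_le {m s t u M N : ℝ} (hm : 0 < m) (hst : s < t) (hsu : s < u) :
    ¬ ∀ i, m * roomR i ^ s ≤ M * roomR i ^ t + N * roomR i ^ u := by
  intro h
  have h0 : ∀ e : ℝ, 0 < e → Tendsto (fun i => roomR i ^ e) atTop (𝓝 0) := fun e he => by
    simpa [Real.zero_rpow he.ne'] using
      tendsto_roomR.rpow_const (p := e) (Or.inr he.le)
  have h1 : Tendsto (fun i => M * roomR i ^ (t - s) + N * roomR i ^ (u - s)) atTop (𝓝 0) := by
    simpa using ((h0 _ (sub_pos.2 hst)).const_mul M).add ((h0 _ (sub_pos.2 hsu)).const_mul N)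
  have h2 : m ≤ 0 := ge_of_tendsto' h1 fun i => by
    have hr := roomR_pos i
    have hrs : 0 < roomR i ^ s := Real.rpow_pos_of_pos hr s
    rw [Real.rpow_sub hr, Real.rpow_sub hr, mul_div_assoc', mul_div_assoc', ← add_div,
      le_div_iff₀ hrs]
    exact h i
  linarith

/-- **Theorem 3.4 (sharpness).** For `p > 1`, `a ≥ 0`, `0 < β ≤ 1` and `b` with
`(a+n)(2β/(1+β)) < n + b − p` (here `n = 2`), there exists a bounded proper subdomain
`Ω ⊆ ℝ²` satisfying the `β`-quasihyperbolic boundary condition on which the weighted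
Korn inequality `(K_{p,a,b−p})` fails. -/
theorem qhbc_korn_sharp (β p a b : ℝ) (hβ0 : 0 < β) (hβ : β ≤ 1) (hp : 1 < p) (ha : 0 ≤ a)
    (hcond : (a + 2) * (2 * β / (1 + β)) < 2 + b - p) :
    ∃ Ω : Set (Evec 2), IsBoundedDomain Ω ∧ Ω ≠ univ ∧ QHBC Ω β ∧
      ¬ ∃ C > 0, ∀ v : Evec 2 → Evec 2, MemW1Vec Ω p a a v →
        wIp Ω Ω p a (DvLen v) ≤
          ENNReal.ofReal C *
            (wIp Ω Ω p (b - p) (epsLen v) + wIp Ω Ω p a (fun x => ‖v x‖)) := by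
  have hτ : 1 ≤ (1 + β) / (2 * β) := by rw [le_div_iff₀ (by positivity)]; linarith
  refine ⟨roomsDom ((1 + β) / (2 * β)), isBoundedDomain_roomsDom hβ0 hβ, roomsDom_ne_univ hτ,
    qhbc_roomsDom hβ0 hβ, ?_⟩
  rintro ⟨C, hC, hkorn⟩
  obtain ⟨P⟩ := CutoffProfile.nonempty
  have hp0 : 0 < p := by linarith
  have hexp : a + 2 < (1 + β) / (2 * β) * (b - p + 2) := by
    have h : (a + 2) * (2 * β) < (2 + b - p) * (1 + β) := by
      rw [← mul_div_assoc, div_lt_iff₀ (by linarith)] at hcond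
      exact hcond
    rw [div_mul_eq_mul_div, lt_div_iff₀ (by positivity)]
    linarith
  have hB : 0 < b - p + 2 :=
    (mul_pos_iff_of_pos_left (by linarith)).1 (by linarith : 0 < (1 + β) / (2 * β) * (b - p + 2))
  generalize (1 + β) / (2 * β) = τ at *
  set A₁ : ℝ := (2 * P.K ^ 2) ^ p * 3 ^ |b - p| * 4 * 2 ^ (p + (b - p) + 1) /
    (p + (b - p) + 1) with hA₁
  set A₂ : ℝ := (3 * P.K ^ 2 + 3) ^ p * 5 ^ a * 16 with hA₂
  have hK := P.K_pos
  have h1 : 0 < p + (b - p) + 1 := by linarith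
  have hA₁0 : 0 ≤ A₁ := by positivity
  have hA₂0 : 0 ≤ A₂ := by positivity
  refine not_forall_rpow_le (m := (1 / 2) ^ (a + 2)) (s := a + 2) (t := τ * (b - p + 2))
    (u := p + a + 2) (M := C * A₁) (N := C * A₂) (by positivity) hexp (by linarith) fun i => ?_
  have hr := roomR_pos i
  have key : ENNReal.ofReal ((1 / 2) ^ (a + 2) * roomR i ^ (a + 2)) ≤
      ENNReal.ofReal C * (ENNReal.ofReal (A₁ * gapH τ i ^ (b - p + 2)) +
        ENNReal.ofReal (A₂ * roomR i ^ (p + a + 2))) :=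
    (le_wIp_DvLen P hτ hp0 ha i).trans <|
      (hkorn _ (memW1Vec_bendField P hτ hp0 ha i)).trans <| by
        gcongr
        · exact wIp_epsLen_le P hτ hp0 i (by linarith)
        · exact wIp_norm_le P hτ hp0 ha i
  rw [gapH, ← Real.rpow_mul hr.le, ← ENNReal.ofReal_add (by positivity) (by positivity),
    ← ENNReal.ofReal_mul hC.le, ENNReal.ofReal_le_ofReal_iff (by positivity)] at key
  linarith
end
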